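/- For every real K ≥ 1 there exists a constant C = C(K) ≥ 1 such that the following holds (the Green–Ruzsa theorem). Let G be an additive abelian group and let A ⊆ G be a finite nonempty set with |A + A| ≤ K·|A|. Then there exist a finite subgroup H of G, a natural number r ≤ C, elements u₁, …, u_r ∈ G, and positive integers N₁, …, N_r such that A ⊆ H + P where P = {n₁u₁ + ⋯ + n_r u_r : n_i ∈ ℤ, 0 ≤ n_i < N_i}, and |H|·N₁·⋯·N_r ≤ C·|A|. -/

import Mathlib

open Pointwise

/-- A monotone sequence of polynomial growth has a scale at which it is both doubling and
almost stationary; the doubling constant depends only on the degree. -/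
theorem exists_stationary_doubling_scale (d : ℕ) (C δ : ℝ) (hδ : 0 < δ) :
    ∃ M : ℕ, ∀ f : ℕ → ℝ, Monotone f → 0 < f 1 → (∀ n, 1 ≤ n → f n ≤ C * (n : ℝ) ^ d * f 1) →
      ∃ m, 1 ≤ m ∧ m + 1 ≤ M ∧ f (m + 1) ≤ (1 + δ) * f m ∧
        f (2 * (m + 1)) ≤ 4 ^ (d + 1) * f (m + 1) := by
  obtain ⟨n₀, hn₀⟩ := pow_unbounded_of_one_lt ((4 : ℝ) ^ (d + 1)) (by linarith : 1 < 1 + δ)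
  have hn₀pos : 1 ≤ n₀ := by
    rcases Nat.eq_zero_or_pos n₀ with h | h
    · subst h
      have : (1 : ℝ) ≤ 4 ^ (d + 1) := one_le_pow₀ (by norm_num)
      simp at hn₀
      linarith
    · exact h
  obtain ⟨J, hJ⟩ := pow_unbounded_of_one_lt (C * (n₀ : ℝ) ^ d) (by norm_num : (1 : ℝ) < 4)
  refine ⟨2 * (n₀ * 4 ^ J), fun f hf h1 hgrow ↦ ?_⟩
  have hpos : ∀ n, 1 ≤ n → 0 < f n := fun n hn ↦ h1.trans_le (hf hn)
  have hn1 : ∀ j, 1 ≤ n₀ * 4 ^ j := fun j ↦ Nat.mul_pos hn₀pos (by positivity)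
  obtain ⟨j, hjJ, hj⟩ : ∃ j < J, f (n₀ * 4 ^ (j + 1)) ≤ 4 ^ (d + 1) * f (n₀ * 4 ^ j) := by
    by_contra! hcon
    have key : ∀ j ≤ J, (4 : ℝ) ^ ((d + 1) * j) * f 1 ≤ f (n₀ * 4 ^ j) := by
      intro j
      induction j with
      | zero => intro _; simpa using hf hn₀pos
      | succ j ih =>
        intro hj
        have h2 := ih (by omega)
        have h3 := hcon j (by omega)
        calc (4 : ℝ) ^ ((d + 1) * (j + 1)) * f 1
            = 4 ^ (d + 1) * (4 ^ ((d + 1) * j) * f 1) := by ring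
          _ ≤ 4 ^ (d + 1) * f (n₀ * 4 ^ j) := by gcongr
          _ ≤ _ := h3.le
    have h2 := (key J le_rfl).trans (hgrow _ (hn1 J))
    have h3 := le_of_mul_le_mul_right h2 h1
    push_cast at h3
    have h4 : (4 : ℝ) ^ ((d + 1) * J) = 4 ^ J * (4 ^ J) ^ d := by ring
    rw [h4, mul_pow, ← mul_assoc] at h3
    have := le_of_mul_le_mul_right h3 (by positivity)
    linarith
  set n := n₀ * 4 ^ j with hn
  have hnn₀ : n₀ ≤ n := Nat.le_mul_of_pos_right _ (by positivity)
  have hnJ : 4 * n ≤ n₀ * 4 ^ J := by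
    calc 4 * n = n₀ * 4 ^ (j + 1) := by rw [hn]; ring
      _ ≤ _ := by gcongr <;> omega
  obtain ⟨i, hin, hi⟩ : ∃ i < n, f (n + i + 1) ≤ (1 + δ) * f (n + i) := by
    by_contra! hcon
    have key : ∀ i ≤ n, (1 + δ) ^ i * f n ≤ f (n + i) := by
      intro i
      induction i with
      | zero => simp
      | succ i ih =>
        intro hi
        calc (1 + δ) ^ (i + 1) * f n = (1 + δ) * ((1 + δ) ^ i * f n) := by ring
          _ ≤ (1 + δ) * f (n + i) := by gcongr; exact ih (by omega)
          _ ≤ _ := (hcon i (by omega)).le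
    have h2 := key n le_rfl
    have h3 : f (n + n) ≤ f (n₀ * 4 ^ (j + 1)) := hf (by rw [pow_succ, ← mul_assoc]; omega)
    have h4 := le_of_mul_le_mul_right (h2.trans (h3.trans hj)) (hpos n (hn1 j))
    have h5 : (1 + δ) ^ n₀ ≤ (1 + δ) ^ n := pow_le_pow_right₀ (by linarith) hnn₀
    linarith
  have hn1' := hn1 j
  refine ⟨n + i, by omega, by omega, hi, ?_⟩
  calc f (2 * (n + i + 1)) ≤ f (n₀ * 4 ^ (j + 1)) := hf (by rw [pow_succ, ← mul_assoc]; omega)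
    _ ≤ _ := hj
    _ ≤ _ := by gcongr; exact hf (by omega)

section Growth
variable {G : Type*} [AddCommGroup G] [DecidableEq G]

theorem card_nsmul_le (X : Finset G) (n : ℕ) : (n • X).card ≤ (n + 1) ^ X.card := by
  classical
  let f : (X → Fin (n + 1)) → G := fun c ↦ ∑ x, (c x : ℕ) • (x : G)
  have key : ∀ m, ∀ y ∈ m • X, ∃ c : X → ℕ, (∀ x, c x ≤ m) ∧ ∑ x, c x • (x : G) = y := by
    intro m
    induction m with
    | zero => intro y hy; exact ⟨0, by simp, by simpa [eq_comm] using hy⟩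
    | succ m ih =>
      intro y hy
      rw [succ_nsmul] at hy
      obtain ⟨z, hz, x, hx, rfl⟩ := Finset.mem_add.1 hy
      obtain ⟨c, hc, rfl⟩ := ih z hz
      refine ⟨c + Pi.single ⟨x, hx⟩ 1, fun t ↦ ?_, ?_⟩
      · have h1 := hc t
        by_cases h : t = ⟨x, hx⟩
        · subst h; simp; omega
        · simp [h]; omega
      · simp [add_smul, Finset.sum_add_distrib, Pi.single_apply, ite_smul]
  have hsub : n • X ⊆ Finset.univ.image f := by
    intro y hy
    obtain ⟨c, hc, rfl⟩ := key n y hy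
    exact Finset.mem_image.2 ⟨fun x ↦ ⟨c x, Nat.lt_succ_of_le (hc x)⟩, Finset.mem_univ _, rfl⟩
  calc (n • X).card ≤ (Finset.univ.image f).card := Finset.card_le_card hsub
    _ ≤ _ := Finset.card_image_le
    _ = _ := by simp

theorem card_nsmul_sub_nsmul_le {K : ℝ} {A : Finset G} (hA : A.Nonempty)
    (hK : ((A + A).card : ℝ) ≤ K * A.card) (m n : ℕ) :
    ((m • A - n • A).card : ℝ) ≤ K ^ (m + n) * A.card := by
  have h := Finset.pluennecke_ruzsa_inequality_nsmul_sub_nsmul_add hA A m n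
  have h' : ((m • A - n • A).card : ℝ) ≤ ((A + A).card / A.card : ℝ) ^ (m + n) * A.card := by
    simpa using (NNRat.cast_le (K := ℝ)).2 h
  have hpos : (0 : ℝ) < A.card := by exact_mod_cast hA.card_pos
  refine h'.trans ?_
  gcongr
  rwa [div_le_iff₀ hpos]

theorem nsmul_card_growth {K : ℝ} {A : Finset G} (hA : A.Nonempty)
    (hK : ((A + A).card : ℝ) ≤ K * A.card) {n : ℕ} (hn : 1 ≤ n) :
    ((n • A).card : ℝ) ≤ K ^ 2 * (n : ℝ) ^ ⌊K ^ 4⌋₊ * A.card := by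
  have hpos : (0 : ℝ) < A.card := by exact_mod_cast hA.card_pos
  obtain ⟨F, -, hF, hcov⟩ := Finset.ruzsa_covering_add (A := A + A - A) (B := A) (K := K ^ 4) hA (by
    have h := card_nsmul_sub_nsmul_le hA hK 3 1
    rwa [show (3 • A - 1 • A) = A + A - A + A by
      rw [one_nsmul, succ_nsmul, two_nsmul, add_sub_right_comm]] at h)
  have key : ∀ m : ℕ, (m + 1) • A - A ⊆ m • F + (A - A) := by
    intro m
    induction m with
    | zero => simp
    | succ m ih =>
      calc (m + 1 + 1) • A - A = A + ((m + 1) • A - A) := by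
            rw [succ_nsmul, add_comm, add_sub_assoc]
        _ ⊆ A + (m • F + (A - A)) := Finset.add_subset_add_left ih
        _ = m • F + (A + A - A) := by rw [add_left_comm, add_sub_assoc]
        _ ⊆ m • F + (F + (A - A)) := Finset.add_subset_add_left hcov
        _ = _ := by rw [succ_nsmul, add_assoc]
  obtain ⟨m, rfl⟩ : ∃ m, n = m + 1 := ⟨n - 1, by omega⟩
  have hFc : F.card ≤ ⌊K ^ 4⌋₊ := Nat.le_floor hF
  have hAA : ((A - A).card : ℝ) ≤ K ^ 2 * A.card := by
    simpa using card_nsmul_sub_nsmul_le hA hK 1 1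
  have h1 : ((m + 1) • A).card ≤ ((m + 1) • A - A).card := by
    obtain ⟨a, ha⟩ := hA
    rw [sub_eq_add_neg]
    exact Finset.card_le_card_add_right ⟨-a, Finset.neg_mem_neg ha⟩
  have h2 : ((m + 1) • A - A).card ≤ (m + 1) ^ ⌊K ^ 4⌋₊ * (A - A).card :=
    calc _ ≤ (m • F + (A - A)).card := Finset.card_le_card (key m)
      _ ≤ (m • F).card * (A - A).card := Finset.card_add_le
      _ ≤ (m + 1) ^ F.card * (A - A).card := by gcongr; exact card_nsmul_le F m
      _ ≤ _ := by gcongr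
  calc (((m + 1) • A).card : ℝ) ≤ ((m + 1) ^ ⌊K ^ 4⌋₊ * (A - A).card : ℕ) := by
        exact_mod_cast h1.trans h2
    _ = ((m + 1 : ℕ) : ℝ) ^ ⌊K ^ 4⌋₊ * (A - A).card := by push_cast; rfl
    _ ≤ ((m + 1 : ℕ) : ℝ) ^ ⌊K ^ 4⌋₊ * (K ^ 2 * A.card) := by gcongr
    _ = _ := by ring

/-- Some dilate `(m + 1) • A` of a set of small doubling is almost stationary, with doubling
constant bounded in terms of `K` only. -/
theorem exists_stationary_nsmul (K δ : ℝ) (hδ : 0 < δ) :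
    ∃ M : ℕ, ∀ (G : Type*) [AddCommGroup G] [DecidableEq G] (A : Finset G), A.Nonempty →
      ((A + A).card : ℝ) ≤ K * A.card →
      ∃ m, m + 1 ≤ M ∧ (((m + 1) • A).card : ℝ) ≤ (1 + δ) * (m • A).card ∧
        (((m + 1) • A + (m + 1) • A).card : ℝ) ≤
          4 ^ (⌊K ^ 4⌋₊ + 1) * ((m + 1) • A).card := by
  obtain ⟨M, hM⟩ := exists_stationary_doubling_scale ⌊K ^ 4⌋₊ (K ^ 2) δ hδ
  refine ⟨M, fun G _ _ A hA hK ↦ ?_⟩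
  obtain ⟨m, -, hm, h1, h2⟩ := hM (fun n ↦ ((n • A).card : ℝ)) (by
    refine monotone_nat_of_le_succ fun n ↦ ?_
    rw [succ_nsmul]
    exact_mod_cast Finset.card_le_card_add_right hA) (by simpa using hA) (by
    intro n hn
    simpa using nsmul_card_growth hA hK hn)
  refine ⟨m, hm, h1, ?_⟩
  rwa [← two_nsmul, ← mul_nsmul']
end Growth

section Fourier
variable {G : Type*} [AddCommGroup G] [Fintype G]

/-- The `ρ`-large spectrum of `A`. -/
noncomputable def largeSpec (A : Finset G) (ρ : ℝ) : Finset (AddChar G ℂ) :=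
  open Classical in {γ | ρ * A.card ≤ ‖∑ a ∈ A, γ a‖}

/-- The characters that are `ε`-almost constant on `A`. -/
noncomputable def almostConst (A : Finset G) (ε : ℝ) : Finset (AddChar G ℂ) :=
  open Classical in {γ | ∀ a ∈ A, ∀ b ∈ A, ‖γ a - γ b‖ ≤ ε}

theorem mem_largeSpec {A : Finset G} {ρ : ℝ} {γ : AddChar G ℂ} :
    γ ∈ largeSpec A ρ ↔ ρ * A.card ≤ ‖∑ a ∈ A, γ a‖ := by simp [largeSpec]

theorem mem_almostConst {A : Finset G} {ε : ℝ} {γ : AddChar G ℂ} :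
    γ ∈ almostConst A ε ↔ ∀ a ∈ A, ∀ b ∈ A, ‖γ a - γ b‖ ≤ ε := by simp [almostConst]

theorem norm_charSum_sq (A : Finset G) (γ : AddChar G ℂ) :
    ((‖∑ a ∈ A, γ a‖ ^ 2 : ℝ) : ℂ) = ∑ p ∈ A ×ˢ A, γ (p.1 - p.2) := by
  rw [Complex.ofReal_pow, ← Complex.mul_conj', map_sum, Finset.sum_mul_sum, Finset.sum_product]
  refine Finset.sum_congr rfl fun a _ ↦ Finset.sum_congr rfl fun b _ ↦ ?_
  rw [sub_eq_add_neg, AddChar.map_add_eq_mul, AddChar.map_neg_eq_conj]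

theorem sum_norm_charSum_sq [DecidableEq G] (A : Finset G) :
    ∑ γ : AddChar G ℂ, ‖∑ a ∈ A, γ a‖ ^ 2 = Fintype.card G * A.card := by
  have h : ((∑ γ : AddChar G ℂ, ‖∑ a ∈ A, γ a‖ ^ 2 : ℝ) : ℂ) = Fintype.card G * A.card := by
    rw [Complex.ofReal_sum]
    simp_rw [norm_charSum_sq]
    rw [Finset.sum_comm]
    simp_rw [AddChar.sum_apply_eq_ite, sub_eq_zero]
    rw [Finset.sum_product]
    simp [mul_comm]
  exact_mod_cast h

theorem sum_norm_charSum_pow_four_mul [DecidableEq G] (A : Finset G) (x : G) :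
    ∑ γ : AddChar G ℂ, ((‖∑ a ∈ A, γ a‖ ^ 4 : ℝ) : ℂ) * γ x = Fintype.card G *
      ((((A ×ˢ A) ×ˢ A ×ˢ A).filter
        fun p ↦ p.1.1 - p.1.2 + (p.2.1 - p.2.2) + x = 0).card : ℂ) := by
  have h (γ : AddChar G ℂ) : ((‖∑ a ∈ A, γ a‖ ^ 4 : ℝ) : ℂ) * γ x =
      ∑ p ∈ (A ×ˢ A) ×ˢ A ×ˢ A, γ (p.1.1 - p.1.2 + (p.2.1 - p.2.2) + x) := by
    rw [show ‖∑ a ∈ A, γ a‖ ^ 4 = ‖∑ a ∈ A, γ a‖ ^ 2 * ‖∑ a ∈ A, γ a‖ ^ 2 by ring,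
      Complex.ofReal_mul, norm_charSum_sq, Finset.sum_mul_sum, ← Finset.sum_product',
      Finset.sum_mul]
    simp_rw [AddChar.map_add_eq_mul]
  simp_rw [h]
  rw [Finset.sum_comm]
  simp_rw [AddChar.sum_apply_eq_ite]
  rw [← Finset.sum_filter, Finset.sum_const, nsmul_eq_mul, mul_comm]

theorem card_pow_three_le_sum [DecidableEq G] {K : ℝ} {A : Finset G} (hA : A.Nonempty)
    (hK : ((A + A).card : ℝ) ≤ K * A.card) :
    (Fintype.card G : ℝ) * A.card ^ 3 ≤ K * ∑ γ : AddChar G ℂ, ‖∑ a ∈ A, γ a‖ ^ 4 := by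
  have h := sum_norm_charSum_pow_four_mul A 0
  have hE : (((A ×ˢ A) ×ˢ A ×ˢ A).filter
      fun p ↦ p.1.1 - p.1.2 + (p.2.1 - p.2.2) + 0 = 0).card = A.addEnergy A := by
    rw [Finset.addEnergy]
    congr 1
    refine Finset.filter_congr fun p _ ↦ ?_
    rw [add_zero, ← sub_eq_zero (a := p.1.1 + p.2.1)]
    exact Eq.congr_left (by abel)
  simp only [AddChar.map_zero_eq_one, mul_one, hE] at h
  have h' : ∑ γ : AddChar G ℂ, ‖∑ a ∈ A, γ a‖ ^ 4 = Fintype.card G * A.addEnergy A := by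
    exact_mod_cast h
  have hen : (A.card : ℝ) ^ 2 * A.card ^ 2 ≤ (A + A).card * A.addEnergy A := by
    exact_mod_cast Finset.le_card_add_mul_addEnergy A A
  have hpos : (0 : ℝ) < A.card := by exact_mod_cast hA.card_pos
  have h2 : (A.card : ℝ) ^ 3 ≤ K * A.addEnergy A := by
    refine le_of_mul_le_mul_right ?_ hpos
    calc (A.card : ℝ) ^ 3 * A.card = A.card ^ 2 * A.card ^ 2 := by ring
      _ ≤ ((A + A).card : ℝ) * A.addEnergy A := hen
      _ ≤ K * A.card * A.addEnergy A := by gcongr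
      _ = _ := by ring
  rw [h']
  calc (Fintype.card G : ℝ) * A.card ^ 3 ≤ Fintype.card G * (K * A.addEnergy A) := by gcongr
    _ = _ := by ring

theorem norm_charSum_le (A : Finset G) (γ : AddChar G ℂ) : ‖∑ a ∈ A, γ a‖ ≤ A.card := by
  refine (norm_sum_le _ _).trans ?_
  simp [AddChar.norm_apply]

theorem sum_compl_largeSpec_le [DecidableEq G] (A : Finset G) {ρ : ℝ} :
    ∑ γ ∈ (largeSpec A ρ)ᶜ, ‖∑ a ∈ A, γ a‖ ^ 4 ≤ ρ ^ 2 * (Fintype.card G * A.card ^ 3) := by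
  calc ∑ γ ∈ (largeSpec A ρ)ᶜ, ‖∑ a ∈ A, γ a‖ ^ 4
      ≤ ∑ γ ∈ (largeSpec A ρ)ᶜ, (ρ * A.card) ^ 2 * ‖∑ a ∈ A, γ a‖ ^ 2 := by
        refine Finset.sum_le_sum fun γ hγ ↦ ?_
        rw [Finset.mem_compl, mem_largeSpec, not_le] at hγ
        rw [show ‖∑ a ∈ A, γ a‖ ^ 4 = ‖∑ a ∈ A, γ a‖ ^ 2 * ‖∑ a ∈ A, γ a‖ ^ 2 by ring]
        gcongr
    _ ≤ ∑ γ : AddChar G ℂ, (ρ * A.card) ^ 2 * ‖∑ a ∈ A, γ a‖ ^ 2 :=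
        Finset.sum_le_univ_sum_of_nonneg fun _ ↦ by positivity
    _ = _ := by rw [← Finset.mul_sum, sum_norm_charSum_sq]; ring

theorem card_largeSpec_le [DecidableEq G] {A : Finset G} (hA : A.Nonempty) {ρ : ℝ} (hρ : 0 ≤ ρ) :
    ρ ^ 2 * A.card * (largeSpec A ρ).card ≤ Fintype.card G := by
  have hpos : (0 : ℝ) < A.card := by exact_mod_cast hA.card_pos
  refine le_of_mul_le_mul_right ?_ hpos
  calc ρ ^ 2 * A.card * (largeSpec A ρ).card * A.card
      = ∑ γ ∈ largeSpec A ρ, (ρ * A.card) ^ 2 := by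
        rw [Finset.sum_const, nsmul_eq_mul]; ring
    _ ≤ ∑ γ ∈ largeSpec A ρ, ‖∑ a ∈ A, γ a‖ ^ 2 := by
        refine Finset.sum_le_sum fun γ hγ ↦ ?_
        have := mem_largeSpec.1 hγ
        gcongr
    _ ≤ ∑ γ : AddChar G ℂ, ‖∑ a ∈ A, γ a‖ ^ 2 :=
        Finset.sum_le_univ_sum_of_nonneg fun _ ↦ by positivity
    _ = _ := sum_norm_charSum_sq A

theorem card_le_mul_card_largeSpec [DecidableEq G] {K ρ : ℝ} {A : Finset G} (hA : A.Nonempty)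
    (hK0 : 0 ≤ K)
    (hK : ((A + A).card : ℝ) ≤ K * A.card) (hρK : 2 * K * ρ ^ 2 ≤ 1) :
    (Fintype.card G : ℝ) ≤ 2 * K * A.card * (largeSpec A ρ).card := by
  have hpos : (0 : ℝ) < A.card := by exact_mod_cast hA.card_pos
  have h1 := card_pow_three_le_sum hA hK
  have h2 := sum_compl_largeSpec_le A (ρ := ρ)
  have h3 : ∑ γ ∈ largeSpec A ρ, ‖∑ a ∈ A, γ a‖ ^ 4 ≤ (largeSpec A ρ).card * A.card ^ 4 := by
    rw [← nsmul_eq_mul]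
    refine Finset.sum_le_card_nsmul _ _ _ fun γ _ ↦ ?_
    have := norm_charSum_le A γ
    gcongr
  rw [← Finset.sum_add_sum_compl (largeSpec A ρ)] at h1
  have h4 : K * ∑ γ ∈ (largeSpec A ρ)ᶜ, ‖∑ a ∈ A, γ a‖ ^ 4 ≤
      (Fintype.card G * A.card ^ 3) / 2 :=
    calc _ ≤ K * (ρ ^ 2 * (Fintype.card G * A.card ^ 3)) := by gcongr
      _ = (2 * K * ρ ^ 2) * (Fintype.card G * A.card ^ 3) / 2 := by ring
      _ ≤ 1 * (Fintype.card G * A.card ^ 3) / 2 := by gcongr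
      _ = _ := by ring
  have h5 : K * ∑ γ ∈ largeSpec A ρ, ‖∑ a ∈ A, γ a‖ ^ 4 ≤
      K * ((largeSpec A ρ).card * A.card ^ 4) := by gcongr
  refine le_of_mul_le_mul_right ?_ (pow_pos hpos 3)
  have : 2 * K * A.card * (largeSpec A ρ).card * A.card ^ 3 =
      2 * (K * ((largeSpec A ρ).card * A.card ^ 4)) := by ring
  rw [mul_add] at h1
  linarith

/-- Bogolyubov's lemma, phrased with the whole large spectrum. -/
theorem mem_two_nsmul_sub_of_largeSpec [DecidableEq G] {K ρ : ℝ} {A : Finset G} (hA : A.Nonempty)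
    (hK0 : 0 < K)
    (hK : ((A + A).card : ℝ) ≤ K * A.card) (hρK : 8 * K * ρ ^ 2 ≤ 1) {x : G}
    (hx : ∀ γ ∈ largeSpec A ρ, ‖1 - γ x‖ ≤ 1 / 2) : x ∈ 2 • A - 2 • A := by
  by_contra hcon
  have hpos : (0 : ℝ) < A.card := by exact_mod_cast hA.card_pos
  have hGpos : (0 : ℝ) < Fintype.card G := by exact_mod_cast Fintype.card_pos
  have h0 := sum_norm_charSum_pow_four_mul A x
  rw [Finset.filter_false_of_mem, Finset.card_empty, Nat.cast_zero, mul_zero] at h0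
  swap
  · rintro ⟨⟨a, b⟩, c, d⟩ hp heq
    simp only [Finset.mem_product] at hp
    refine hcon ?_
    rw [two_nsmul]
    have : x = (b + d) - (a + c) := by
      rw [← sub_eq_zero, ← heq]; abel
    rw [this]
    exact Finset.sub_mem_sub (Finset.add_mem_add hp.1.2 hp.2.2) (Finset.add_mem_add hp.1.1 hp.2.1)
  have h1 := card_pow_three_le_sum hA hK
  have h2 := sum_compl_largeSpec_le A (ρ := ρ)
  set E := ∑ γ : AddChar G ℂ, ‖∑ a ∈ A, γ a‖ ^ 4 with hE
  have hsum : (E : ℂ) = ∑ γ : AddChar G ℂ, ((‖∑ a ∈ A, γ a‖ ^ 4 : ℝ) : ℂ) * (1 - γ x) := by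
    simp_rw [mul_sub, Finset.sum_sub_distrib, mul_one, h0, sub_zero, hE, Complex.ofReal_sum]
  have hE0 : 0 ≤ E := by positivity
  have hle : E ≤ ∑ γ : AddChar G ℂ, ‖∑ a ∈ A, γ a‖ ^ 4 * ‖1 - γ x‖ := by
    calc E = ‖(E : ℂ)‖ := by rw [Complex.norm_real, Real.norm_of_nonneg hE0]
      _ ≤ _ := by
        rw [hsum]
        refine (norm_sum_le _ _).trans (le_of_eq (Finset.sum_congr rfl fun γ _ ↦ ?_))
        rw [norm_mul, Complex.norm_real, Real.norm_of_nonneg (by positivity)]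
  rw [← Finset.sum_add_sum_compl (largeSpec A ρ)] at hle
  have h3 : ∑ γ ∈ largeSpec A ρ, ‖∑ a ∈ A, γ a‖ ^ 4 * ‖1 - γ x‖ ≤ E * (1 / 2) := by
    calc _ ≤ ∑ γ ∈ largeSpec A ρ, ‖∑ a ∈ A, γ a‖ ^ 4 * (1 / 2) :=
          Finset.sum_le_sum fun γ hγ ↦ by have := hx γ hγ; gcongr
      _ ≤ ∑ γ : AddChar G ℂ, ‖∑ a ∈ A, γ a‖ ^ 4 * (1 / 2) :=
          Finset.sum_le_univ_sum_of_nonneg fun _ ↦ by positivity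
      _ = _ := by rw [← Finset.sum_mul]
  have h4 : ∑ γ ∈ (largeSpec A ρ)ᶜ, ‖∑ a ∈ A, γ a‖ ^ 4 * ‖1 - γ x‖ ≤
      ρ ^ 2 * (Fintype.card G * A.card ^ 3) * 2 := by
    calc _ ≤ ∑ γ ∈ (largeSpec A ρ)ᶜ, ‖∑ a ∈ A, γ a‖ ^ 4 * 2 := by
          refine Finset.sum_le_sum fun γ _ ↦ ?_
          have : ‖1 - γ x‖ ≤ 2 := (norm_sub_le _ _).trans (by
            rw [AddChar.norm_apply, norm_one]; norm_num)
          gcongr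
      _ ≤ _ := by rw [← Finset.sum_mul]; gcongr
  have h5 : K * (ρ ^ 2 * (Fintype.card G * A.card ^ 3) * 2) ≤
      (Fintype.card G * A.card ^ 3) / 4 := by
    calc _ = (8 * K * ρ ^ 2) * (Fintype.card G * A.card ^ 3) / 4 := by ring
      _ ≤ 1 * (Fintype.card G * A.card ^ 3) / 4 := by gcongr
      _ = _ := by ring
  have h6 : 0 < (Fintype.card G : ℝ) * A.card ^ 3 := by positivity
  have h7 : K * E ≤ K * (E * (1 / 2) + ρ ^ 2 * (Fintype.card G * A.card ^ 3) * 2) := by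
    gcongr; linarith
  linarith

theorem largeSpec_subset_almostConst [DecidableEq G] {A : Finset G} (hA : A.Nonempty)
    {m : ℕ} {ρ ε : ℝ}
    (hρ : 0 < ρ) (hε : 0 < ε) (hε1 : ε ≤ 1)
    (hm : (((m + 1) • A).card : ℝ) ≤ (1 + ε * ρ / 4) * (m • A).card) :
    largeSpec ((m + 1) • A) ρ ⊆ almostConst A ε := by
  intro γ hγ
  rw [mem_largeSpec] at hγ
  rw [mem_almostConst]
  set B := (m + 1) • A with hB
  set B' := m • A with hB'
  have hBpos : (0 : ℝ) < B.card := by exact_mod_cast (hA.nsmul (n := m + 1)).card_pos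
  have hB'B : (B'.card : ℝ) ≤ B.card := by
    rw [hB, succ_nsmul]
    exact_mod_cast Finset.card_le_card_add_right hA
  have hδ : 0 < ε * ρ / 4 := by positivity
  have key : ∀ a ∈ A, ‖∑ b ∈ B, γ b - γ a * ∑ b ∈ B', γ b‖ ≤ ε * ρ / 4 * B.card := by
    intro a ha
    have hinj : Function.Injective (fun b ↦ a + b) := add_right_injective a
    have hsub : B'.image (fun b ↦ a + b) ⊆ B := by
      intro y hy
      obtain ⟨b, hb, rfl⟩ := Finset.mem_image.1 hy
      rw [hB, succ_nsmul, add_comm a b]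
      exact Finset.add_mem_add hb ha
    have heq : γ a * ∑ b ∈ B', γ b = ∑ b ∈ B'.image (fun b ↦ a + b), γ b := by
      rw [Finset.sum_image hinj.injOn, Finset.mul_sum]
      simp_rw [AddChar.map_add_eq_mul]
    rw [heq, ← Finset.sum_sdiff hsub, add_sub_cancel_right]
    refine (norm_charSum_le _ γ).trans ?_
    rw [Finset.cast_card_sdiff hsub, Finset.card_image_of_injective _ hinj]
    have : ε * ρ / 4 * B'.card ≤ ε * ρ / 4 * B.card := by gcongr
    linarith
  intro a ha a' ha'
  have h1 := key a ha
  have h2 := key a' ha'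
  have h3 : ρ * B.card - ε * ρ / 4 * B.card ≤ ‖∑ b ∈ B', γ b‖ := by
    have := norm_sub_norm_le (∑ b ∈ B, γ b) (γ a * ∑ b ∈ B', γ b)
    rw [norm_mul, AddChar.norm_apply, one_mul] at this
    linarith
  have h4 : ‖γ a - γ a'‖ * ‖∑ b ∈ B', γ b‖ ≤ 2 * (ε * ρ / 4 * B.card) := by
    rw [← norm_mul, sub_mul]
    have := norm_sub_le (∑ b ∈ B, γ b - γ a' * ∑ b ∈ B', γ b)
      (∑ b ∈ B, γ b - γ a * ∑ b ∈ B', γ b)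
    rw [sub_sub_sub_cancel_left] at this
    linarith
  have h5 : ρ / 2 * B.card ≤ ‖∑ b ∈ B', γ b‖ := by
    have : ε * (ρ * B.card) ≤ 1 * (ρ * B.card) := by gcongr
    have : 0 < ρ * B.card := by positivity
    linarith
  refine le_of_mul_le_mul_right (a := ρ / 2 * B.card) ?_ (by positivity)
  calc ‖γ a - γ a'‖ * (ρ / 2 * B.card) ≤ ‖γ a - γ a'‖ * ‖∑ b ∈ B', γ b‖ := by gcongr
    _ ≤ _ := h4
    _ = _ := by ring

theorem largeSpec_mul_almostConst_subset {A : Finset G} {ρ ε : ℝ} :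
    largeSpec A ρ * almostConst A ε ⊆ largeSpec A (ρ - ε) := by
  intro γ hγ
  obtain ⟨φ, hφ, ψ, hψ, rfl⟩ := Finset.mem_mul.1 hγ
  rw [mem_largeSpec] at *
  rw [mem_almostConst] at hψ
  rcases A.eq_empty_or_nonempty with rfl | ⟨a₀, ha₀⟩
  · simp
  have h1 : ‖∑ a ∈ A, (φ * ψ) a - ψ a₀ * ∑ a ∈ A, φ a‖ ≤ ε * A.card := by
    rw [Finset.mul_sum, ← Finset.sum_sub_distrib, mul_comm ε, ← nsmul_eq_mul]
    refine (norm_sum_le _ _).trans (Finset.sum_le_card_nsmul _ _ _ fun a ha ↦ ?_)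
    rw [AddChar.mul_apply, mul_comm, ← sub_mul, norm_mul, AddChar.norm_apply, mul_one]
    exact hψ a ha a₀ ha₀
  have h2 := norm_sub_norm_le (ψ a₀ * ∑ a ∈ A, φ a) (∑ a ∈ A, (φ * ψ) a)
  rw [norm_mul, AddChar.norm_apply, one_mul, norm_sub_rev] at h2
  linarith

theorem norm_one_sub_add_le (γ : AddChar G ℂ) (x y : G) :
    ‖1 - γ (x + y)‖ ≤ ‖1 - γ x‖ + ‖1 - γ y‖ := by
  have : 1 - γ (x + y) = (1 - γ x) + γ x * (1 - γ y) := by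
    rw [AddChar.map_add_eq_mul]; ring
  rw [this]
  refine (norm_add_le _ _).trans ?_
  rw [norm_mul, AddChar.norm_apply, one_mul]

theorem norm_one_sub_le_of_mem_almostConst [DecidableEq G] {A : Finset G} {ε : ℝ} {γ : AddChar G ℂ}
    (hγ : γ ∈ almostConst A ε) (n : ℕ) :
    ∀ x ∈ n • A - n • A, ‖1 - γ x‖ ≤ n * ε := by
  rw [mem_almostConst] at hγ
  induction n with
  | zero => simp
  | succ n ih =>
    intro x hx
    rw [succ_nsmul, add_sub_add_comm] at hx
    obtain ⟨y, hy, z, hz, rfl⟩ := Finset.mem_add.1 hx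
    obtain ⟨a, ha, b, hb, rfl⟩ := Finset.mem_sub.1 hz
    refine (norm_one_sub_add_le γ _ _).trans ?_
    have h1 : ‖1 - γ (a - b)‖ = ‖γ b - γ a‖ := by
      rw [← one_mul ‖1 - γ (a - b)‖, ← AddChar.norm_apply γ b, ← norm_mul, mul_sub,
        ← AddChar.map_add_eq_mul, mul_one, add_sub_cancel]
    rw [h1]
    push_cast
    linarith [ih y hy, hγ b hb a ha]
end Fourier

/-- A Bogolyubov-type lemma for sparse sets: inside `4 • A - 4 • A`, a Bohr set of bounded rank lies
in `2 • A - 2 • A`. -/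
theorem exists_bohr_subset_of_finite (K : ℝ) (hK1 : 1 ≤ K) :
    ∃ C : ℕ, ∀ (G : Type*) [AddCommGroup G] [DecidableEq G] [Finite G] (A : Finset G),
      A.Nonempty → ((A + A).card : ℝ) ≤ K * A.card →
      ∃ S : Finset (AddChar G ℂ), S.card ≤ C ∧ ∀ x ∈ 4 • A - 4 • A,
        (∀ γ ∈ S, ‖1 - γ x‖ ≤ 1 / 4) → x ∈ 2 • A - 2 • A := by
  set K' : ℝ := 4 ^ (⌊K ^ 4⌋₊ + 1) with hK'
  have hK'1 : 1 ≤ K' := one_le_pow₀ (by norm_num)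
  set ρ : ℝ := 1 / (8 * K) with hρ
  set ρ' : ℝ := 1 / (2 * K') with hρ'
  have hρ0 : 0 < ρ := by positivity
  have hρ'0 : 0 < ρ' := by positivity
  have hρK : 8 * K * ρ = 1 := by rw [hρ]; field_simp
  have hρK' : 2 * K' * ρ' = 1 := by rw [hρ']; field_simp
  have hρ1 : ρ ≤ 1 / 8 := by nlinarith
  have hρ'1 : ρ' ≤ 1 := by nlinarith
  obtain ⟨M, hM⟩ := exists_stationary_nsmul K (ρ / 4 * ρ' / 4) (by positivity)
  refine ⟨⌊8 * K' * K ^ M / ρ ^ 2⌋₊, fun G _ _ _ A hA hK ↦ ?_⟩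
  have := Fintype.ofFinite G
  obtain ⟨m, hmM, hm, hm2⟩ := hM G A hA hK
  have hpos : (0 : ℝ) < A.card := by exact_mod_cast hA.card_pos
  have hΓ : (Fintype.card G : ℝ) ≤ 2 * K' * K ^ M * A.card * (almostConst A (ρ / 4)).card := by
    calc (Fintype.card G : ℝ)
        ≤ 2 * K' * ((m + 1) • A).card * (largeSpec ((m + 1) • A) ρ').card :=
          card_le_mul_card_largeSpec hA.nsmul (by positivity) hm2 (by nlinarith)
      _ ≤ 2 * K' * (K ^ M * A.card) * (almostConst A (ρ / 4)).card := by
          have h1 : (((m + 1) • A).card : ℝ) ≤ K ^ (m + 1) * A.card := by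
            simpa using card_nsmul_sub_nsmul_le hA hK (m + 1) 0
          have h2 := largeSpec_subset_almostConst hA hρ'0 (by positivity : 0 < ρ / 4)
            (by linarith) hm
          gcongr
          exact h1.trans (by gcongr)
      _ = _ := by ring
  have hne : (almostConst A (ρ / 4)).Nonempty := ⟨1, by
    rw [mem_almostConst]
    intro a _ b _
    simpa using by positivity⟩
  obtain ⟨S, -, hS, hcov⟩ := Finset.ruzsa_covering_mul (A := largeSpec A ρ)
    (B := almostConst A (ρ / 4)) (K := 8 * K' * K ^ M / ρ ^ 2) hne (by
      have h1 : ((largeSpec A ρ * almostConst A (ρ / 4)).card : ℝ) ≤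
          (largeSpec A (ρ / 2)).card := by
        refine Nat.cast_le.2 (Finset.card_le_card (largeSpec_mul_almostConst_subset.trans ?_))
        intro γ hγ
        rw [mem_largeSpec] at *
        refine le_trans ?_ hγ
        gcongr
        linarith
      have h2 := (card_largeSpec_le hA (by positivity : 0 ≤ ρ / 2)).trans hΓ
      refine h1.trans ?_
      have h3 : 0 < (ρ / 2) ^ 2 * A.card := by positivity
      refine le_of_mul_le_mul_left (h2.trans (le_of_eq ?_)) h3
      field_simp
      ring)
  refine ⟨S, Nat.le_floor hS, fun x hx hSx ↦ ?_⟩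
  refine mem_two_nsmul_sub_of_largeSpec hA (by positivity) hK
    (ρ := ρ) (by nlinarith) fun γ hγ ↦ ?_
  obtain ⟨σ, hσ, τ, hτ, rfl⟩ := Finset.mem_mul.1 (hcov hγ)
  obtain ⟨φ, hφ, ψ, hψ, rfl⟩ := Finset.mem_div.1 hτ
  have h1 := hSx σ hσ
  have h2 := norm_one_sub_le_of_mem_almostConst hφ 4 x hx
  have h3 := norm_one_sub_le_of_mem_almostConst hψ 4 (-x) (by
    rw [← neg_sub] at hx
    simpa using Finset.neg_mem_neg hx)
  have hev : (σ * (φ / ψ)) x = σ x * (φ x * ψ (-x)) := by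
    rw [div_eq_mul_inv, AddChar.mul_apply, AddChar.mul_apply, AddChar.inv_apply]
  have h4 : 1 - (σ * (φ / ψ)) x = (1 - σ x) + σ x * ((1 - φ x) + φ x * (1 - ψ (-x))) := by
    rw [hev]; ring
  rw [h4]
  refine (norm_add_le _ _).trans ?_
  rw [norm_mul, AddChar.norm_apply, one_mul]
  have h5 := norm_add_le (1 - φ x) (φ x * (1 - ψ (-x)))
  rw [norm_mul, AddChar.norm_apply, one_mul] at h5
  push_cast at h2 h3
  linarith

theorem Finset.image_sub_of_hom {G H : Type*} [AddCommGroup G] [AddCommGroup H] [DecidableEq G]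
    [DecidableEq H] (f : G →+ H) (s t : Finset G) : (s - t).image f = s.image f - t.image f :=
  Finset.image_image₂_distrib (map_sub f)

theorem isOfFinAddOrder_addCircle_rat (t : AddCircle (1 : ℚ)) : IsOfFinAddOrder t := by
  obtain ⟨q, rfl⟩ := QuotientAddGroup.mk_surjective t
  exact AddCircle.isOfFinAddOrder_iff_exists_rat_eq_div.2 ⟨q, by simp⟩

/-- Finitely generated abelian groups are residually finite. -/
theorem exists_finite_quotient_of_finset.{v} {G : Type v} [AddCommGroup G] [AddGroup.FG G]
    (F : Finset G) :
    ∃ (Q : Type v) (_ : AddCommGroup Q) (_ : Finite Q) (ψ : G →+ Q),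
      ∀ x ∈ F, ψ x = 0 → x = 0 := by
  choose! c hc using fun (x : G) (hx : x ≠ 0) ↦
    CharacterModule.exists_character_apply_ne_zero_of_ne_zero hx
  let ψ : G →+ (F → AddCircle (1 : ℚ)) := AddMonoidHom.pi fun x ↦ c x
  have htors : IsAddTorsion ψ.range := by
    intro t
    rw [← AddSubmonoid.isOfFinAddOrder_coe]
    exact IsOfFinAddOrder.pi fun _ ↦ isOfFinAddOrder_addCircle_rat _
  refine ⟨ψ.range, inferInstance, AddCommGroup.finite_of_fg_isAddTorsion _ htors,
    ψ.rangeRestrict, fun x hx h ↦ ?_⟩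
  by_contra hne
  exact hc x hne (congr_fun (congr_arg Subtype.val h) ⟨x, hx⟩)

/-- The Bogolyubov-type lemma for finitely generated groups. -/
theorem exists_bohr_subset_of_fg (K : ℝ) (hK1 : 1 ≤ K) :
    ∃ C : ℕ, ∀ (G : Type*) [AddCommGroup G] [DecidableEq G] [AddGroup.FG G] (A : Finset G),
      A.Nonempty → ((A + A).card : ℝ) ≤ K * A.card →
      ∃ S : Finset (AddChar G ℂ), S.card ≤ C ∧ (∀ γ ∈ S, ∀ x, ‖γ x‖ = 1) ∧
        ∀ x ∈ 4 • A - 4 • A, (∀ γ ∈ S, ‖1 - γ x‖ ≤ 1 / 4) → x ∈ 2 • A - 2 • A := by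
  classical
  obtain ⟨C, hC⟩ := exists_bohr_subset_of_finite K hK1
  refine ⟨C, fun G _ _ _ A hA hK ↦ ?_⟩
  obtain ⟨Q, _, _, ψ, hψ⟩ :=
    exists_finite_quotient_of_finset ((A - A) ∪ (4 • A - 4 • A - (2 • A - 2 • A)))
  have hinj : Set.InjOn ψ A := fun a ha b hb hab ↦
    sub_eq_zero.1 (hψ _ (Finset.mem_union_left _ (Finset.sub_mem_sub ha hb))
      (by rw [map_sub, hab, sub_self]))
  have himg (n : ℕ) : n • A.image ψ = (n • A).image ψ := (Finset.image_nsmul ψ A n).symm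
  obtain ⟨S, hS, hSA⟩ := hC Q (A.image ψ) (hA.image _) (by
    rw [← Finset.image_add, Finset.card_image_of_injOn hinj]
    refine le_trans ?_ hK
    exact_mod_cast Finset.card_image_le)
  refine ⟨S.image fun γ ↦ γ.compAddMonoidHom ψ, Finset.card_image_le.trans hS, ?_, ?_⟩
  · simp only [Finset.mem_image]
    rintro _ ⟨γ, -, rfl⟩ x
    simp [AddChar.norm_apply]
  · intro x hx hSx
    have h := hSA (ψ x) (by
      rw [himg, ← Finset.image_sub_of_hom]
      exact Finset.mem_image_of_mem _ hx) fun γ hγ ↦ hSx _ (Finset.mem_image_of_mem _ hγ)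
    rw [himg, ← Finset.image_sub_of_hom] at h
    obtain ⟨y, hy, hyx⟩ := Finset.mem_image.1 h
    rwa [sub_eq_zero.1 (hψ (x - y) (Finset.mem_union_right _ (Finset.sub_mem_sub hx hy))
      (by rw [map_sub, hyx, sub_self]))]

section Geometry

/-- Elements of minimal norm in the fibres of the quotient by a shortest vector. -/
theorem norm_le_norm_sub_smul_add {V : Type*} [SeminormedAddCommGroup V] [NormedSpace ℝ V]
    {a v : V} (h1 : ‖a‖ ≤ ‖a - v‖) (h2 : ‖a‖ ≤ ‖a + v‖) (t : ℝ) :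
    ‖a‖ ≤ ‖a - t • v‖ + ‖v‖ / 2 := by
  wlog ht : 0 ≤ t generalizing v t
  · have := this (v := -v) (by simpa [sub_neg_eq_add] using h2)
      (by simpa [← sub_eq_add_neg] using h1)
      (-t) (by linarith)
    simpa using this
  have hv := norm_nonneg v
  rcases le_total t 1 with h | h
  · have e1 : ‖a‖ ≤ ‖a - t • v‖ + t * ‖v‖ := by
      calc ‖a‖ = ‖(a - t • v) + t • v‖ := by rw [sub_add_cancel]
        _ ≤ ‖a - t • v‖ + ‖t • v‖ := norm_add_le _ _
        _ = _ := by rw [norm_smul, Real.norm_of_nonneg ht]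
    have e2 : ‖a‖ ≤ ‖a - t • v‖ + (1 - t) * ‖v‖ := by
      calc ‖a‖ ≤ ‖a - v‖ := h1
        _ = ‖(a - t • v) - (1 - t) • v‖ := by congr 1; module
        _ ≤ ‖a - t • v‖ + ‖(1 - t) • v‖ := norm_sub_le _ _
        _ = _ := by rw [norm_smul, Real.norm_of_nonneg (by linarith)]
    nlinarith
  · have e : t * ‖a - v‖ ≤ (t - 1) * ‖a‖ + ‖a - t • v‖ := by
      calc t * ‖a - v‖ = ‖t • (a - v)‖ := by rw [norm_smul, Real.norm_of_nonneg ht]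
        _ = ‖(t - 1) • a + (a - t • v)‖ := by congr 1; module
        _ ≤ ‖(t - 1) • a‖ + ‖a - t • v‖ := norm_add_le _ _
        _ = _ := by rw [norm_smul, Real.norm_of_nonneg (by linarith)]
    have : t * ‖a‖ ≤ t * ‖a - v‖ := by gcongr
    linarith

/-- A finite set which is a symmetric "local group" at scale `c`. -/
structure IsLocalGroup {V : Type*} [SeminormedAddCommGroup V] (W : Finset V) (c : ℝ) : Prop where
  zero_mem : 0 ∈ W
  neg_mem : ∀ a ∈ W, -a ∈ W
  add_mem : ∀ a ∈ W, ∀ b ∈ W, ‖a‖ + ‖b‖ ≤ c → a + b ∈ W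

namespace IsLocalGroup
variable {V : Type*} [SeminormedAddCommGroup V] {W : Finset V} {c : ℝ}

theorem sub_mem (hW : IsLocalGroup W c) {a b : V} (ha : a ∈ W) (hb : b ∈ W)
    (h : ‖a‖ + ‖b‖ ≤ c) : a - b ∈ W := by
  rw [sub_eq_add_neg]
  exact hW.add_mem a ha _ (hW.neg_mem b hb) (by rwa [norm_neg])

variable [NormedSpace ℝ V]

theorem norm_pos (hW : IsLocalGroup W c) (hc : 0 ≤ c) {a : V} (ha : a ∈ W) (h0 : a ≠ 0) :
    0 < ‖a‖ := by
  refine lt_of_le_of_ne (norm_nonneg a) fun h ↦ ?_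
  have hn (n : ℕ) : ‖n • a‖ = 0 := by
    rw [← Nat.cast_smul_eq_nsmul ℝ, norm_smul, ← h, mul_zero]
  have hmem (n : ℕ) : n • a ∈ W := by
    induction n with
    | zero => simpa using hW.zero_mem
    | succ n ih =>
      rw [succ_nsmul]
      exact hW.add_mem _ ih _ ha (by rw [hn, ← h]; simpa)
  have hinj : Function.Injective fun n : ℕ ↦ n • a := by
    intro m n hmn
    simp only [← Nat.cast_smul_eq_nsmul ℝ] at hmn
    exact_mod_cast smul_left_injective ℝ h0 hmn
  exact Set.infinite_range_of_injective hinj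
    (W.finite_toSet.subset (Set.range_subset_iff.2 hmem))

open Classical in
theorem card_fiber_le (hW : IsLocalGroup W c) {R : ℝ} (hR : 2 * R ≤ c) {v : V} (hv : 0 < ‖v‖)
    (hvR : ‖v‖ ≤ R) (hmin : ∀ a ∈ W, a ≠ 0 → ‖v‖ ≤ ‖a‖) (X : Finset V) (hXW : X ⊆ W)
    (hXR : ∀ x ∈ X, ‖x‖ ≤ R) (hX : ∀ x ∈ X, ∀ y ∈ X, ∃ s : ℝ, x - y = s • v) :
    (X.card : ℝ) ≤ 7 * (R / ‖v‖) := by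
  have hRv : 1 ≤ R / ‖v‖ := by rwa [one_le_div hv]
  rcases X.eq_empty_or_nonempty with rfl | ⟨x₀, hx₀⟩
  · simp; positivity
  choose! s hs using fun x hx ↦ hX x hx x₀ hx₀
  set M : ℕ := ⌈2 * (R / ‖v‖)⌉₊
  have hM : (M : ℝ) ≤ 2 * (R / ‖v‖) + 1 := (Nat.ceil_lt_add_one (by positivity)).le
  have hM' : 2 * (R / ‖v‖) ≤ M := Nat.le_ceil _
  have hinj : Set.InjOn (fun x ↦ ⌊s x⌋) X := by
    intro x hx y hy hxy
    by_contra hne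
    have h1 := Int.abs_sub_lt_one_of_floor_eq_floor hxy
    have h2 : x - y = (s x - s y) • v := by
      rw [sub_smul, ← hs x hx, ← hs y hy]; abel
    have h3 := hmin _ (hW.sub_mem (hXW hx) (hXW hy)
      (by linarith [hXR x hx, hXR y hy])) (sub_ne_zero.2 hne)
    rw [h2, norm_smul, Real.norm_eq_abs] at h3
    nlinarith
  have hcard : X.card ≤ (Finset.Icc (-M : ℤ) M).card := by
    refine Finset.card_le_card_of_injOn _ (fun x hx ↦ ?_) hinj
    have h1 : |s x| * ‖v‖ ≤ 2 * R := by
      rw [← Real.norm_eq_abs, ← norm_smul, ← hs x hx]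
      linarith [norm_sub_le x x₀, hXR x hx, hXR x₀ hx₀]
    have h2 : |s x| ≤ M := by
      refine le_trans ?_ hM'
      rwa [← mul_div_assoc, le_div_iff₀ hv]
    rw [abs_le] at h2
    simp only [Finset.coe_Icc, Set.mem_Icc]
    constructor
    · rw [Int.le_floor]; push_cast; exact h2.1
    · exact_mod_cast (Int.floor_le _).trans h2.2
  rw [Int.card_Icc] at hcard
  have : (X.card : ℝ) ≤ 2 * M + 1 := by
    have : X.card ≤ 2 * M + 1 := by omega
    exact_mod_cast this
  linarith

theorem exists_lift (hW : IsLocalGroup W c) {v : V} (hvW : v ∈ W)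
    (hvc : 2 * ‖v‖ ≤ c) {w : V ⧸ (Submodule.span ℝ {v})} {a : V} (ha : a ∈ W) (hac : ‖a‖ ≤ c / 2)
    (haw : Submodule.Quotient.mk a = w) :
    ∃ b ∈ W, ‖b‖ ≤ c / 2 ∧ ‖b‖ ≤ ‖w‖ + ‖v‖ / 2 ∧ Submodule.Quotient.mk b = w := by
  classical
  obtain ⟨b, hb, hbmin⟩ := Finset.exists_min_image
    (W.filter fun b ↦ ‖b‖ ≤ c / 2 ∧ (Submodule.Quotient.mk b : V ⧸ (Submodule.span ℝ {v})) = w)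
    norm ⟨a, by simp [ha, hac, haw]⟩
  simp only [Finset.mem_filter] at hb hbmin
  obtain ⟨hbW, hbc, hbw⟩ := hb
  have hv0 : (Submodule.Quotient.mk v : V ⧸ (Submodule.span ℝ {v})) = 0 :=
    (Submodule.Quotient.mk_eq_zero _).2 (Submodule.mem_span_singleton_self v)
  have h1 : ‖b‖ ≤ ‖b - v‖ := by
    rcases le_total ‖b - v‖ (c / 2) with h | h
    · exact hbmin _ ⟨hW.sub_mem hbW hvW (by linarith), h, by
        rw [Submodule.Quotient.mk_sub, hv0, sub_zero, hbw]⟩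
    · exact hbc.trans h
  have h2 : ‖b‖ ≤ ‖b + v‖ := by
    rcases le_total ‖b + v‖ (c / 2) with h | h
    · exact hbmin _ ⟨hW.add_mem _ hbW _ hvW (by linarith), h, by
        rw [Submodule.Quotient.mk_add, hv0, add_zero, hbw]⟩
    · exact hbc.trans h
  refine ⟨b, hbW, hbc, le_of_forall_pos_le_add fun ε hε ↦ ?_, hbw⟩
  obtain ⟨m, hm, hmε⟩ := Submodule.Quotient.norm_mk_lt w hε
  rw [← hbw, Submodule.Quotient.eq, Submodule.mem_span_singleton] at hm
  obtain ⟨t, ht⟩ := hm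
  have := norm_le_norm_sub_smul_add h1 h2 (-t)
  rw [neg_smul, sub_neg_eq_add, ht, add_sub_cancel] at this
  linarith

/-- In a finite local group inside a real vector space, the points of norm at most `R` are
controlled by a proper progression whose steps lie in the local group. -/
theorem exists_progression.{v} (d : ℕ) : ∀ η : ℝ, 0 < η → ∃ C : ℝ, 1 ≤ C ∧
    ∀ (V : Type v) [SeminormedAddCommGroup V] [NormedSpace ℝ V] [FiniteDimensional ℝ V]
      (W : Finset V) (c R : ℝ), Module.finrank ℝ V = d → IsLocalGroup W c → 0 ≤ R →
      8 * 4 ^ d * R ≤ c →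
      ∃ (r : ℕ) (v : Fin r → V) (N : Fin r → ℕ), r ≤ d ∧ (∀ i, v i ∈ W) ∧
        ∑ i, N i * ‖v i‖ ≤ η * R ∧
        (∀ n : Fin r → ℤ, ∑ i, n i • v i = 0 → n = 0) ∧
        ((W.filter fun x ↦ ‖x‖ ≤ R).card : ℝ) ≤ C * ∏ i, (N i + 1 : ℝ) := by
  classical
  have trivial_case (V : Type v) [SeminormedAddCommGroup V] (W : Finset V) (d : ℕ) (η R C : ℝ)
      (hη : 0 < η) (hR : 0 ≤ R) (hC : 1 ≤ C) (h : ∀ x ∈ W, ‖x‖ ≤ R → x = 0) :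
      ∃ (r : ℕ) (v : Fin r → V) (N : Fin r → ℕ), r ≤ d ∧ (∀ i, v i ∈ W) ∧
        ∑ i, N i * ‖v i‖ ≤ η * R ∧
        (∀ n : Fin r → ℤ, ∑ i, n i • v i = 0 → n = 0) ∧
        ((W.filter fun x ↦ ‖x‖ ≤ R).card : ℝ) ≤ C * ∏ i, (N i + 1 : ℝ) := by
    refine ⟨0, Fin.elim0, Fin.elim0, Nat.zero_le _, fun i ↦ i.elim0, ?_,
      fun n _ ↦ Subsingleton.elim _ _, ?_⟩
    · simpa using by positivity
    · have : (W.filter fun x ↦ ‖x‖ ≤ R).card ≤ 1 := Finset.card_le_one.2 fun a ha b hb ↦ by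
        simp only [Finset.mem_filter] at ha hb
        rw [h a ha.1 ha.2, h b hb.1 hb.2]
      have h1 : ((W.filter fun x ↦ ‖x‖ ≤ R).card : ℝ) ≤ 1 := by exact_mod_cast this
      simpa using h1.trans hC
  induction d with
  | zero =>
    intro η hη
    refine ⟨1, le_rfl, fun V _ _ _ W c R hV _ hR _ ↦ trivial_case V W 0 η R 1 hη hR le_rfl ?_⟩
    have := Module.finrank_zero_iff.1 hV
    exact fun x _ _ ↦ Subsingleton.elim _ _
  | succ d ih =>
    intro η hη
    obtain ⟨C, hC1, hC⟩ := ih (η / 4) (by positivity)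
    refine ⟨max 1 (14 / η * C), le_max_left _ _, fun V _ _ _ W c R hV hW hR hRc ↦ ?_⟩
    by_cases htriv : ∀ x ∈ W, ‖x‖ ≤ R → x = 0
    · exact trivial_case V W _ η R _ hη hR (le_max_left _ _) htriv
    push Not at htriv
    obtain ⟨x₀, hx₀W, hx₀R, hx₀⟩ := htriv
    have h4 : (1 : ℝ) ≤ 4 ^ d := one_le_pow₀ (by norm_num)
    have hRc' : 32 * R ≤ c := by
      refine le_trans ?_ hRc
      rw [pow_succ]
      nlinarith
    have hc : 0 ≤ c := by linarith
    obtain ⟨v, hv, hvmin⟩ := Finset.exists_min_image (W.filter fun x ↦ x ≠ 0) norm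
      ⟨x₀, by simp [hx₀, hx₀W]⟩
    simp only [Finset.mem_filter] at hv hvmin
    obtain ⟨hvW, hv0⟩ := hv
    have hmin : ∀ a ∈ W, a ≠ 0 → ‖v‖ ≤ ‖a‖ := fun a ha ha0 ↦ hvmin a ⟨ha, ha0⟩
    have hvR : ‖v‖ ≤ R := (hmin x₀ hx₀W hx₀).trans hx₀R
    have hvpos : 0 < ‖v‖ := hW.norm_pos hc hvW hv0
    have hRpos : 0 < R := hvpos.trans_le hvR
    let p : Submodule ℝ V := Submodule.span ℝ {v}
    let π : V → V ⧸ p := Submodule.Quotient.mk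
    have hπv : π v = 0 :=
      (Submodule.Quotient.mk_eq_zero p).2 (Submodule.mem_span_singleton_self v)
    have hπle (x : V) : ‖π x‖ ≤ ‖x‖ := Submodule.Quotient.norm_mk_le p x
    let W' : Finset (V ⧸ p) := (W.filter fun x ↦ ‖x‖ ≤ c / 2).image π
    have hlift : ∀ w ∈ W', ∃ b ∈ W, ‖b‖ ≤ c / 2 ∧ ‖b‖ ≤ ‖w‖ + ‖v‖ / 2 ∧ π b = w := by
      intro w hw
      obtain ⟨a, ha, haw⟩ := Finset.mem_image.1 hw
      rw [Finset.mem_filter] at ha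
      exact hW.exists_lift hvW (by linarith) ha.1 ha.2 haw
    have hlift2 : ∀ w ∈ W', ∃ b ∈ W, ‖b‖ ≤ 2 * ‖w‖ ∧ π b = w := by
      intro w hw
      obtain ⟨b, hbW, -, hb, hbw⟩ := hlift w hw
      by_cases h0 : b = 0
      · exact ⟨b, hbW, by simp [h0], hbw⟩
      · exact ⟨b, hbW, by linarith [hmin b hbW h0], hbw⟩
    have hW' : IsLocalGroup W' (c / 4) := by
      refine ⟨?_, ?_, ?_⟩
      · exact Finset.mem_image.2 ⟨0, Finset.mem_filter.2 ⟨hW.zero_mem, by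
          rw [norm_zero]; linarith⟩, rfl⟩
      · intro w hw
        obtain ⟨a, ha, rfl⟩ := Finset.mem_image.1 hw
        rw [Finset.mem_filter] at ha
        exact Finset.mem_image.2 ⟨-a, by simp [hW.neg_mem a ha.1, ha.2], rfl⟩
      · intro w hw w' hw' hww'
        obtain ⟨a, haW, -, ha, rfl⟩ := hlift w hw
        obtain ⟨b, hbW, -, hb, rfl⟩ := hlift w' hw'
        refine Finset.mem_image.2 ⟨a + b, Finset.mem_filter.2 ⟨?_, ?_⟩, rfl⟩
        · exact hW.add_mem a haW b hbW (by linarith)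
        · exact (norm_add_le a b).trans (by linarith)
    have hrank : Module.finrank ℝ (V ⧸ p) = d := by
      have h1 := Submodule.finrank_quotient_add_finrank p
      rw [finrank_span_singleton hv0, hV] at h1
      omega
    obtain ⟨r, w, N, hr, hwW, hsum, hind, hcard⟩ := hC (V ⧸ p) W' (c / 4) R hrank hW' hR (by
      rw [pow_succ] at hRc; linarith)
    choose b hbW hbnorm hbw using fun i ↦ hlift2 (w i) (hwW i)
    set N₀ : ℕ := ⌊η * R / (2 * ‖v‖)⌋₊ with hN₀
    have hN₀le : N₀ * ‖v‖ ≤ η * R / 2 := by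
      have : (N₀ : ℝ) ≤ η * R / (2 * ‖v‖) := Nat.floor_le (by positivity)
      rw [le_div_iff₀ (by positivity)] at this
      linarith
    have hN₀gt : R / ‖v‖ ≤ 2 / η * (N₀ + 1) := by
      have : η * R / (2 * ‖v‖) < N₀ + 1 := Nat.lt_floor_add_one _
      rw [div_lt_iff₀ (by positivity)] at this
      rw [div_le_iff₀ hvpos, div_mul_eq_mul_div, div_mul_eq_mul_div, le_div_iff₀ hη]
      linarith
    refine ⟨r + 1, Fin.cons v b, Fin.cons N₀ N, by omega, ?_, ?_, ?_, ?_⟩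
    · intro i
      refine Fin.cases ?_ (fun j ↦ ?_) i
      · exact hvW
      · exact hbW j
    · rw [Fin.sum_univ_succ]
      simp only [Fin.cons_zero, Fin.cons_succ]
      have : ∑ i, N i * ‖b i‖ ≤ 2 * ∑ i, N i * ‖w i‖ := by
        rw [Finset.mul_sum]
        refine Finset.sum_le_sum fun i _ ↦ ?_
        have := mul_le_mul_of_nonneg_left (hbnorm i) (Nat.cast_nonneg (α := ℝ) (N i))
        linarith
      linarith
    · intro n hn
      rw [Fin.sum_univ_succ] at hn
      simp only [Fin.cons_zero, Fin.cons_succ] at hn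
      have h1 : ∑ i, n (Fin.succ i) • w i = 0 := by
        have h2 := congr_arg p.mkQ hn
        rw [map_add, map_sum, map_zero, map_zsmul] at h2
        simp only [map_zsmul] at h2
        have h3 : p.mkQ v = 0 := hπv
        have h5 (i) : p.mkQ (b i) = w i := hbw i
        simpa [h3, h5] using h2
      have h2 := hind _ h1
      have h3 (i) : n (Fin.succ i) = 0 := congr_fun h2 i
      simp only [h3, zero_smul, Finset.sum_const_zero, add_zero] at hn
      rw [← Int.cast_smul_eq_zsmul ℝ, smul_eq_zero_iff_left hv0] at hn
      ext i
      refine Fin.cases ?_ (fun j ↦ ?_) i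
      · exact_mod_cast hn
      · exact h3 j
    · rw [Fin.prod_univ_succ]
      simp only [Fin.cons_zero, Fin.cons_succ]
      set X := W.filter fun x ↦ ‖x‖ ≤ R with hX
      have hP : 0 ≤ ∏ i, (N i + 1 : ℝ) := by positivity
      have himg : X.image π ⊆ W'.filter fun x ↦ ‖x‖ ≤ R := by
        intro y hy
        obtain ⟨x, hx, rfl⟩ := Finset.mem_image.1 hy
        rw [hX, Finset.mem_filter] at hx
        exact Finset.mem_filter.2 ⟨Finset.mem_image_of_mem _ (Finset.mem_filter.2
          ⟨hx.1, hx.2.trans (by linarith)⟩), (hπle x).trans hx.2⟩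
      have hfib : ∀ y ∈ X.image π, (X.filter fun x ↦ π x = y).card ≤ ⌊7 * (R / ‖v‖)⌋₊ := by
        intro y _
        refine Nat.le_floor (hW.card_fiber_le (by linarith) hvpos hvR hmin _ ?_ ?_ ?_)
        · exact (Finset.filter_subset _ _).trans (Finset.filter_subset _ _)
        · intro x hx
          exact (Finset.mem_filter.1 (Finset.mem_filter.1 hx).1).2
        · intro x hx z hz
          have h1 := (Finset.mem_filter.1 hx).2.trans (Finset.mem_filter.1 hz).2.symm
          obtain ⟨s, hs⟩ := Submodule.mem_span_singleton.1 ((Submodule.Quotient.eq p).1 h1)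
          exact ⟨s, hs.symm⟩
      have h1 : (X.card : ℝ) ≤ (⌊7 * (R / ‖v‖)⌋₊ : ℝ) * (X.image π).card := by
        exact_mod_cast Finset.card_le_mul_card_image X _ hfib
      have h2 : (⌊7 * (R / ‖v‖)⌋₊ : ℝ) ≤ 7 * (R / ‖v‖) := Nat.floor_le (by positivity)
      have h3 : ((X.image π).card : ℝ) ≤ (W'.filter fun x ↦ ‖x‖ ≤ R).card := by
        exact_mod_cast Finset.card_le_card himg
      calc (X.card : ℝ) ≤ 7 * (R / ‖v‖) * (C * ∏ i, (N i + 1 : ℝ)) :=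
            h1.trans (mul_le_mul h2 (h3.trans hcard) (by positivity) (by positivity))
        _ ≤ 7 * (2 / η * (N₀ + 1)) * (C * ∏ i, (N i + 1 : ℝ)) := by gcongr
        _ = (14 / η * C) * ((N₀ + 1) * ∏ i, (N i + 1 : ℝ)) := by ring
        _ ≤ _ := by gcongr; exact le_max_right _ _

end IsLocalGroup
end Geometry

section LocalHom

variable {G V : Type*} [AddCommGroup G] [SeminormedAddCommGroup V]

/-- `θ` respects subtraction as long as the images are `c`-close, and `D` is a finite symmetric
set that is closed under addition of elements with small image. -/
structure IsLocalAddHom (θ : G → V) (D : Finset G) (c : ℝ) : Prop where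
  nonneg : 0 ≤ c
  map_zero : θ 0 = 0
  map_sub : ∀ x y, ‖θ x - θ y‖ ≤ c → θ (x - y) = θ x - θ y
  zero_mem : 0 ∈ D
  neg_mem : ∀ x ∈ D, -x ∈ D
  add_mem : ∀ x ∈ D, ∀ y ∈ D, ‖θ x‖ + ‖θ y‖ ≤ c → x + y ∈ D

namespace IsLocalAddHom
variable {θ : G → V} {D : Finset G} {c : ℝ}

theorem map_neg (h : IsLocalAddHom θ D c) {x : G} (hx : ‖θ x‖ ≤ c) : θ (-x) = -θ x := by
  have := h.map_sub 0 x (by rwa [h.map_zero, zero_sub, norm_neg])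
  rwa [zero_sub, h.map_zero, zero_sub] at this

theorem map_add (h : IsLocalAddHom θ D c) {x y : G} (hxy : ‖θ x‖ + ‖θ y‖ ≤ c) :
    θ (x + y) = θ x + θ y := by
  have h1 : θ (-y) = -θ y := h.map_neg (by linarith [norm_nonneg (θ x)])
  have := h.map_sub x (-y) (by
    rw [h1, sub_neg_eq_add]; exact (norm_add_le _ _).trans hxy)
  rwa [h1, sub_neg_eq_add, sub_neg_eq_add] at this

/-- The kernel of a local homomorphism. -/
def ker (h : IsLocalAddHom θ D c) : AddSubgroup G where
  carrier := {x | x ∈ D ∧ θ x = 0}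
  zero_mem' := ⟨h.zero_mem, h.map_zero⟩
  add_mem' := by
    rintro x y ⟨hx, hx0⟩ ⟨hy, hy0⟩
    have hxy : ‖θ x‖ + ‖θ y‖ ≤ c := by simpa [hx0, hy0] using h.nonneg
    exact ⟨h.add_mem x hx y hy hxy, by rw [h.map_add hxy, hx0, hy0, add_zero]⟩
  neg_mem' := by
    rintro x ⟨hx, hx0⟩
    exact ⟨h.neg_mem x hx, by rw [h.map_neg (by simpa [hx0] using h.nonneg), hx0, neg_zero]⟩

theorem finite_ker (h : IsLocalAddHom θ D c) : (h.ker : Set G).Finite :=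
  D.finite_toSet.subset fun _ hx ↦ hx.1

open Classical in
theorem isLocalGroup_image (h : IsLocalAddHom θ D c) :
    IsLocalGroup ((D.filter fun x ↦ ‖θ x‖ ≤ c).image θ) c where
  zero_mem := Finset.mem_image.2
    ⟨0, Finset.mem_filter.2 ⟨h.zero_mem, by simpa [h.map_zero] using h.nonneg⟩, h.map_zero⟩
  neg_mem := by
    intro a ha
    obtain ⟨x, hx, rfl⟩ := Finset.mem_image.1 ha
    rw [Finset.mem_filter] at hx
    have := h.map_neg hx.2
    exact Finset.mem_image.2 ⟨-x, Finset.mem_filter.2 ⟨h.neg_mem x hx.1, by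
      rw [this, norm_neg]; exact hx.2⟩, this⟩
  add_mem := by
    intro a ha b hb hab
    obtain ⟨x, hx, rfl⟩ := Finset.mem_image.1 ha
    obtain ⟨y, hy, rfl⟩ := Finset.mem_image.1 hb
    rw [Finset.mem_filter] at hx hy
    have := h.map_add hab
    exact Finset.mem_image.2 ⟨x + y, Finset.mem_filter.2 ⟨h.add_mem x hx.1 y hy.1 hab, by
      rw [this]; exact (norm_add_le _ _).trans hab⟩, this⟩

variable [NormedSpace ℝ V]

theorem nsmul_mem (h : IsLocalAddHom θ D c) {x : G} (hx : x ∈ D) (n : ℕ) (hn : n * ‖θ x‖ ≤ c) :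
    n • x ∈ D ∧ θ (n • x) = n • θ x := by
  induction n with
  | zero => simp [h.zero_mem, h.map_zero]
  | succ n ih =>
    push_cast at hn
    obtain ⟨h1, h2⟩ := ih (by linarith [norm_nonneg (θ x)])
    have h3 : ‖θ (n • x)‖ + ‖θ x‖ ≤ c := by
      rw [h2, ← Nat.cast_smul_eq_nsmul ℝ, norm_smul, Real.norm_natCast]; linarith
    rw [succ_nsmul, succ_nsmul, h.map_add h3, h2]
    exact ⟨h.add_mem _ h1 _ hx h3, rfl⟩

theorem sum_mem (h : IsLocalAddHom θ D c) {ι : Type*} (s : Finset ι) {x : ι → G} (hx : ∀ i, x i ∈ D)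
    (n : ι → ℕ) (hn : ∑ i ∈ s, n i * ‖θ (x i)‖ ≤ c) :
    ∑ i ∈ s, n i • x i ∈ D ∧ θ (∑ i ∈ s, n i • x i) = ∑ i ∈ s, n i • θ (x i) := by
  classical
  induction s using Finset.induction_on with
  | empty => simp [h.zero_mem, h.map_zero]
  | insert i s hi ih =>
    rw [Finset.sum_insert hi] at hn ⊢
    rw [Finset.sum_insert hi]
    have h0 : 0 ≤ ∑ i ∈ s, n i * ‖θ (x i)‖ := by positivity
    have h0' : 0 ≤ n i * ‖θ (x i)‖ := by positivity
    obtain ⟨h1, h2⟩ := ih (by linarith)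
    obtain ⟨h3, h4⟩ := h.nsmul_mem (hx i) (n i) (by linarith)
    have key (a : V) (m : ℕ) : ‖m • a‖ = m * ‖a‖ := by
      rw [← Nat.cast_smul_eq_nsmul ℝ, norm_smul, Real.norm_natCast]
    have h5 : ‖θ (n i • x i)‖ + ‖θ (∑ i ∈ s, n i • x i)‖ ≤ c := by
      rw [h2, h4, key]
      refine le_trans ?_ hn
      gcongr
      exact (norm_sum_le _ _).trans (le_of_eq (Finset.sum_congr rfl fun j _ ↦ key _ _))
    rw [h.map_add h5, h2, h4]
    exact ⟨h.add_mem _ h3 _ h1 h5, rfl⟩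

end IsLocalAddHom

open Classical in
/-- The part of a local homomorphism near `0` is controlled by a proper coset progression. -/
theorem IsLocalAddHom.exists_cosetProgression.{u, v} (d : ℕ) : ∃ C : ℝ, 1 ≤ C ∧
    ∀ (G : Type u) (V : Type v) [AddCommGroup G] [SeminormedAddCommGroup V] [NormedSpace ℝ V]
      [FiniteDimensional ℝ V] (θ : G → V) (D : Finset G) (c R : ℝ) (h : IsLocalAddHom θ D c),
      Module.finrank ℝ V = d → 0 ≤ R → 8 * 4 ^ d * R ≤ c →
      ∃ (r : ℕ) (x : Fin r → G) (N : Fin r → ℕ), r ≤ d ∧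
        (∀ y ∈ h.ker, ∀ n : Fin r → ℕ, (∀ i, n i ≤ N i) → y + ∑ i, n i • x i ∈ D) ∧
        (∀ y ∈ h.ker, ∀ y' ∈ h.ker, ∀ n n' : Fin r → ℕ, (∀ i, n i ≤ N i) → (∀ i, n' i ≤ N i) →
          y + ∑ i, n i • x i = y' + ∑ i, n' i • x i → y = y' ∧ n = n') ∧
        ((D.filter fun x ↦ ‖θ x‖ ≤ R).card : ℝ) ≤
          C * ((h.ker : Set G).ncard * ∏ i, (N i + 1 : ℝ)) := by
  obtain ⟨C, hC1, hC⟩ := IsLocalGroup.exists_progression.{v} d 1 one_pos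
  refine ⟨C, hC1, fun G V _ _ _ _ θ D c R h hV hR hRc ↦ ?_⟩
  obtain ⟨r, v, N, hr, hvW, hsum, hind, hcard⟩ := hC V _ c R hV h.isLocalGroup_image hR hRc
  rw [one_mul] at hsum
  have h4 : (1 : ℝ) ≤ 4 ^ d := one_le_pow₀ (by norm_num)
  have hRc' : 8 * R ≤ c := by
    refine le_trans ?_ hRc
    nlinarith
  choose x hx hxv using fun i ↦ Finset.mem_image.1 (hvW i)
  have hxD (i) : x i ∈ D := (Finset.mem_filter.1 (hx i)).1
  have hmain (n : Fin r → ℕ) (hn : ∀ i, n i ≤ N i) : ‖θ (∑ i, n i • x i)‖ ≤ c ∧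
      ∑ i, n i • x i ∈ D ∧ θ (∑ i, n i • x i) = ∑ i, n i • v i := by
    have h1 : ∑ i, n i * ‖θ (x i)‖ ≤ c := by
      calc ∑ i, n i * ‖θ (x i)‖ ≤ ∑ i, N i * ‖v i‖ := by
            refine Finset.sum_le_sum fun i _ ↦ ?_
            rw [hxv]
            have := hn i
            gcongr
        _ ≤ c := by linarith
    obtain ⟨h2, h3⟩ := h.sum_mem Finset.univ hxD n h1
    simp only [hxv] at h1 h3
    refine ⟨?_, h2, h3⟩
    rw [h3]
    refine (norm_sum_le _ _).trans (le_trans (le_of_eq ?_) h1)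
    refine Finset.sum_congr rfl fun i _ ↦ ?_
    rw [← Nat.cast_smul_eq_nsmul ℝ, norm_smul, Real.norm_natCast]
  have hker (y : G) (hy : y ∈ h.ker) (z : G) (hz : ‖θ z‖ ≤ c) (hzD : z ∈ D) :
      y + z ∈ D ∧ θ (y + z) = θ z := by
    have h1 : ‖θ y‖ + ‖θ z‖ ≤ c := by simpa [hy.2] using hz
    exact ⟨h.add_mem _ hy.1 _ hzD h1, by rw [h.map_add h1, hy.2, zero_add]⟩
  refine ⟨r, x, N, hr, ?_, ?_, ?_⟩
  · intro y hy n hn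
    exact (hker y hy _ (hmain n hn).1 (hmain n hn).2.1).1
  · intro y hy y' hy' n n' hn hn' heq
    have h1 := (hker y hy _ (hmain n hn).1 (hmain n hn).2.1).2
    have h2 := (hker y' hy' _ (hmain n' hn').1 (hmain n' hn').2.1).2
    rw [heq, h2, (hmain n hn).2.2, (hmain n' hn').2.2] at h1
    have h3 := hind (fun i ↦ (n i : ℤ) - n' i) (by
      simp only [sub_smul, natCast_zsmul, Finset.sum_sub_distrib, h1, sub_self])
    have h5 : n = n' := by
      ext i
      have := congr_fun h3 i
      simp only [Pi.zero_apply] at this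
      omega
    subst h5
    exact ⟨add_right_cancel heq, rfl⟩
  · have hfib : ∀ w ∈ (D.filter fun x ↦ ‖θ x‖ ≤ R).image θ,
        ((D.filter fun x ↦ ‖θ x‖ ≤ R).filter fun x ↦ θ x = w).card ≤ (h.ker : Set G).ncard := by
      intro w hw
      obtain ⟨x₀, hx₀, rfl⟩ := Finset.mem_image.1 hw
      rw [Finset.mem_filter] at hx₀
      rw [← Set.ncard_coe_finset]
      refine Set.ncard_le_ncard_of_injOn (fun x ↦ x - x₀) ?_ (sub_left_injective.injOn)
        h.finite_ker
      intro y hy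
      simp only [Finset.coe_filter, Finset.mem_filter, Set.mem_ofPred_eq] at hy
      obtain ⟨⟨hyD, hyR⟩, hyx⟩ := hy
      refine ⟨?_, ?_⟩
      · rw [sub_eq_add_neg]
        refine h.add_mem y hyD _ (h.neg_mem x₀ hx₀.1) ?_
        rw [h.map_neg (by linarith), norm_neg]
        linarith
      · have : θ y - θ x₀ = 0 := by rw [hyx, sub_self]
        rw [h.map_sub y x₀ (by rw [this, norm_zero]; exact h.nonneg), this]
    have h1 := Finset.card_le_mul_card_image _ _ hfib
    have h2 : (D.filter fun x ↦ ‖θ x‖ ≤ R).image θ ⊆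
        (((D.filter fun x ↦ ‖θ x‖ ≤ c).image θ).filter fun x ↦ ‖x‖ ≤ R) := by
      intro w hw
      obtain ⟨y, hy, rfl⟩ := Finset.mem_image.1 hw
      rw [Finset.mem_filter] at hy
      exact Finset.mem_filter.2 ⟨Finset.mem_image_of_mem _
        (Finset.mem_filter.2 ⟨hy.1, by linarith⟩), hy.2⟩
    have h3 : (((D.filter fun x ↦ ‖θ x‖ ≤ R).image θ).card : ℝ) ≤ C * ∏ i, (N i + 1 : ℝ) :=
      le_trans (by exact_mod_cast Finset.card_le_card h2) hcard
    calc ((D.filter fun x ↦ ‖θ x‖ ≤ R).card : ℝ)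
        ≤ (h.ker : Set G).ncard * ((D.filter fun x ↦ ‖θ x‖ ≤ R).image θ).card := by
          exact_mod_cast h1
      _ ≤ (h.ker : Set G).ncard * (C * ∏ i, (N i + 1 : ℝ)) := by gcongr
      _ = _ := by ring

end LocalHom

section Character
variable {G : Type*} [AddCommGroup G] {γ : AddChar G ℂ}

theorem eq_exp_arg_mul_I (hγ : ∀ x, ‖γ x‖ = 1) (x : G) :
    γ x = Complex.exp (Complex.arg (γ x) * Complex.I) := by
  have := Complex.norm_mul_exp_arg_mul_I (γ x)
  rw [hγ, Complex.ofReal_one, one_mul] at this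
  exact this.symm

theorem arg_map_sub (hγ : ∀ x, ‖γ x‖ = 1) {x y : G}
    (h : |Complex.arg (γ x) - Complex.arg (γ y)| < Real.pi) :
    Complex.arg (γ (x - y)) = Complex.arg (γ x) - Complex.arg (γ y) := by
  rw [abs_lt] at h
  have h1 : γ (x - y) =
      Complex.exp ((Complex.arg (γ x) - Complex.arg (γ y) : ℝ) * Complex.I) := by
    rw [AddChar.map_sub_eq_div, Complex.ofReal_sub, sub_mul, Complex.exp_sub,
      ← eq_exp_arg_mul_I hγ, ← eq_exp_arg_mul_I hγ]
  rw [h1, Complex.exp_mul_I, Complex.arg_cos_add_sin_mul_I ⟨h.1, h.2.le⟩]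

theorem norm_one_sub_le_abs_arg (hγ : ∀ x, ‖γ x‖ = 1) (x : G) :
    ‖1 - γ x‖ ≤ |Complex.arg (γ x)| := by
  conv_lhs => rw [eq_exp_arg_mul_I hγ x]
  rw [norm_sub_rev, mul_comm, ← Real.norm_eq_abs]
  exact Real.norm_exp_I_mul_ofReal_sub_one_le

theorem norm_one_sub_add_le_abs_arg (hγ : ∀ x, ‖γ x‖ = 1) (x y : G) :
    ‖1 - γ (x + y)‖ ≤ |Complex.arg (γ x)| + |Complex.arg (γ y)| := by
  have : 1 - γ (x + y) = (1 - γ x) + γ x * (1 - γ y) := by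
    rw [AddChar.map_add_eq_mul]; ring
  rw [this]
  refine (norm_add_le _ _).trans ?_
  rw [norm_mul, hγ, one_mul]
  exact add_le_add (norm_one_sub_le_abs_arg hγ x) (norm_one_sub_le_abs_arg hγ y)

/-- The arguments of finitely many unitary characters form a local homomorphism. -/
theorem isLocalAddHom_arg [DecidableEq G] {A : Finset G} (hA : A.Nonempty)
    (S : Finset (AddChar G ℂ)) (hS : ∀ γ ∈ S, ∀ x, ‖γ x‖ = 1)
    (hSA : ∀ x ∈ 4 • A - 4 • A, (∀ γ ∈ S, ‖1 - γ x‖ ≤ 1 / 4) → x ∈ 2 • A - 2 • A) :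
    IsLocalAddHom (fun x (γ : S) ↦ Complex.arg (γ.1 x)) (2 • A - 2 • A) (1 / 4) where
  nonneg := by norm_num
  map_zero := by ext γ; simp
  map_sub x y hxy := by
    ext γ
    refine arg_map_sub (hS γ γ.2) (lt_of_le_of_lt ((norm_le_pi_norm _ γ).trans hxy) ?_)
    linarith [Real.pi_gt_three]
  zero_mem := by
    obtain ⟨a, ha⟩ := hA.nsmul (n := 2)
    exact Finset.mem_sub.2 ⟨a, ha, a, ha, sub_self a⟩
  neg_mem x hx := by
    have := Finset.neg_mem_neg hx
    rwa [neg_sub] at this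
  add_mem x hx y hy hxy := by
    refine hSA _ ?_ fun γ hγ ↦ ?_
    · have := Finset.add_mem_add hx hy
      rwa [sub_add_sub_comm, ← add_nsmul] at this
    · refine (norm_one_sub_add_le_abs_arg (hS γ hγ) x y).trans (le_trans ?_ hxy)
      exact add_le_add (norm_le_pi_norm (fun γ : S ↦ Complex.arg (γ.1 x)) ⟨γ, hγ⟩)
        (norm_le_pi_norm (fun γ : S ↦ Complex.arg (γ.1 y)) ⟨γ, hγ⟩)

/-- Pigeonhole: a positive proportion of `A` has close arguments under all characters in `S`. -/
theorem card_le_mul_card_arg_le [DecidableEq G] {A : Finset G}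
    (S : Finset (AddChar G ℂ)) (hS : ∀ γ ∈ S, ∀ x, ‖γ x‖ = 1) {R : ℝ} (hR : 0 < R) (hR1 : R ≤ 1) :
    A.card ≤ ((2 • A - 2 • A).filter
      fun x ↦ ‖fun γ : S ↦ Complex.arg (γ.1 x)‖ ≤ R).card * (2 * ⌈Real.pi / R⌉₊ + 1) ^ S.card := by
  classical
  set θ : G → S → ℝ := fun x γ ↦ Complex.arg (γ.1 x) with hθ
  set M := ⌈Real.pi / R⌉₊ with hM
  let q : G → S → ℤ := fun x γ ↦ ⌊θ x γ / R⌋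
  have himg : (A.image q).card ≤ (2 * M + 1) ^ S.card := by
    have h1 : A.image q ⊆ Fintype.piFinset fun _ : S ↦ Finset.Icc (-M : ℤ) M := by
      intro y hy
      obtain ⟨x, -, rfl⟩ := Finset.mem_image.1 hy
      refine Fintype.mem_piFinset.2 fun γ ↦ ?_
      have h2 : |θ x γ / R| ≤ M := by
        refine le_trans ?_ (Nat.le_ceil _)
        rw [abs_div, abs_of_pos hR]
        gcongr
        exact Complex.abs_arg_le_pi _
      rw [abs_le] at h2
      rw [Finset.mem_Icc]
      constructor
      · rw [Int.le_floor]; push_cast; exact h2.1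
      · exact_mod_cast (Int.floor_le _).trans h2.2
    refine (Finset.card_le_card h1).trans (le_of_eq ?_)
    rw [Fintype.card_piFinset, Finset.prod_const, Finset.card_univ, Fintype.card_coe, Int.card_Icc]
    congr 1
    omega
  have hfib : ∀ y ∈ A.image q, (A.filter fun x ↦ q x = y).card ≤
      ((2 • A - 2 • A).filter fun x ↦ ‖θ x‖ ≤ R).card := by
    intro y hy
    obtain ⟨x₀, hx₀, rfl⟩ := Finset.mem_image.1 hy
    refine Finset.card_le_card_of_injOn (fun x ↦ x - x₀) (fun x hx ↦ ?_)
      sub_left_injective.injOn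
    obtain ⟨hxA, hxq⟩ := Finset.mem_filter.1 hx
    refine Finset.mem_coe.2 (Finset.mem_filter.2 ⟨?_, ?_⟩)
    · rw [two_nsmul]
      exact Finset.mem_sub.2 ⟨x + x₀, Finset.add_mem_add hxA hx₀, x₀ + x₀,
        Finset.add_mem_add hx₀ hx₀, add_sub_add_right_eq_sub x x₀ x₀⟩
    · refine (pi_norm_le_iff_of_nonneg hR.le).2 fun γ ↦ ?_
      have h1 : |θ x γ / R - θ x₀ γ / R| < 1 :=
        Int.abs_sub_lt_one_of_floor_eq_floor (congr_fun hxq γ)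
      rw [← sub_div, abs_div, abs_of_pos hR, div_lt_one hR] at h1
      have h2 : θ (x - x₀) γ = θ x γ - θ x₀ γ :=
        arg_map_sub (hS γ γ.2) (h1.trans (by linarith [Real.pi_gt_three]))
      rw [h2, Real.norm_eq_abs]
      exact h1.le
  exact (Finset.card_le_mul_card_image A _ hfib).trans (by gcongr)

end Character

/-- If `A` has small doubling then `2 • A - 2 • A` contains a large proper coset progression. -/
theorem exists_large_cosetProgression.{u} (K : ℝ) (hK1 : 1 ≤ K) :
    ∃ (k : ℕ) (C : ℝ), 1 ≤ C ∧
      ∀ (G : Type u) [AddCommGroup G] [DecidableEq G] [AddGroup.FG G] (A : Finset G),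
        A.Nonempty → ((A + A).card : ℝ) ≤ K * A.card →
        ∃ (H : AddSubgroup G) (r : ℕ) (x : Fin r → G) (N : Fin r → ℕ),
          (H : Set G).Finite ∧ r ≤ k ∧
          (∀ y ∈ H, ∀ n : Fin r → ℕ, (∀ i, n i ≤ N i) → y + ∑ i, n i • x i ∈ 2 • A - 2 • A) ∧
          (∀ y ∈ H, ∀ y' ∈ H, ∀ n n' : Fin r → ℕ, (∀ i, n i ≤ N i) → (∀ i, n' i ≤ N i) →
            y + ∑ i, n i • x i = y' + ∑ i, n' i • x i → y = y' ∧ n = n') ∧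
          (A.card : ℝ) ≤ C * ((H : Set G).ncard * ∏ i, (N i + 1 : ℝ)) := by
  obtain ⟨k, hk⟩ := exists_bohr_subset_of_fg.{u} K hK1
  choose f hf1 hf using IsLocalAddHom.exists_cosetProgression.{u, u}
  set R : ℝ := 1 / (32 * 4 ^ k) with hR
  have h4 : (1 : ℝ) ≤ 4 ^ k := one_le_pow₀ (by norm_num)
  have hR0 : 0 < R := by positivity
  have hRk : 32 * 4 ^ k * R = 1 := by rw [hR]; field_simp
  have hR1 : R ≤ 1 := by nlinarith
  set M := ⌈Real.pi / R⌉₊ with hM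
  set C₀ : ℝ := ∑ d ∈ Finset.range (k + 1), f d with hC₀
  have hfC (d : ℕ) (hd : d ≤ k) : f d ≤ C₀ :=
    Finset.single_le_sum (f := f) (fun i _ ↦ zero_le_one.trans (hf1 i))
      (Finset.mem_range.2 (Nat.lt_succ_of_le hd))
  have hC₀1 : 1 ≤ C₀ := (hf1 0).trans (hfC 0 (Nat.zero_le _))
  have hM1 : (1 : ℝ) ≤ (2 * M + 1) := by linarith [Nat.cast_nonneg (α := ℝ) M]
  refine ⟨k, C₀ * (2 * M + 1) ^ k, one_le_mul_of_one_le_of_one_le hC₀1 (one_le_pow₀ hM1),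
    fun G _ _ _ A hA hK ↦ ?_⟩
  obtain ⟨S, hSk, hS, hSA⟩ := hk G A hA hK
  have h := isLocalAddHom_arg hA S hS hSA
  obtain ⟨r, x, N, hr, hmem, hinj, hcard⟩ := hf S.card G (S → ℝ) _ _ _ R h (by simp) hR0.le (by
    have : (4 : ℝ) ^ S.card ≤ 4 ^ k := pow_le_pow_right₀ (by norm_num) hSk
    nlinarith)
  refine ⟨h.ker, r, x, N, h.finite_ker, hr.trans hSk, hmem, hinj, ?_⟩
  have h1 : (A.card : ℝ) ≤ ((2 • A - 2 • A).filter
      fun x ↦ ‖fun γ : S ↦ Complex.arg (γ.1 x)‖ ≤ R).card * (2 * M + 1) ^ S.card := by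
    exact_mod_cast card_le_mul_card_arg_le S hS hR0 hR1
  have hP : 0 ≤ ((h.ker : Set G).ncard * ∏ i, (N i + 1 : ℝ)) := by positivity
  calc (A.card : ℝ) ≤ _ := h1
    _ ≤ f S.card * ((h.ker : Set G).ncard * ∏ i, (N i + 1 : ℝ)) * (2 * M + 1) ^ S.card := by
        gcongr
    _ ≤ C₀ * ((h.ker : Set G).ncard * ∏ i, (N i + 1 : ℝ)) * (2 * M + 1) ^ k := by
        gcongr
        exact hfC _ hSk
    _ = _ := by ring

/-- The Green–Ruzsa theorem for finitely generated groups. -/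
theorem exists_cosetProgression_superset_of_fg.{u} (K : ℝ) (hK : 1 ≤ K) :
    ∃ C : ℝ, 1 ≤ C ∧
      ∀ (G : Type u) [AddCommGroup G] [DecidableEq G] [AddGroup.FG G] (A : Finset G),
        A.Nonempty → ((A + A).card : ℝ) ≤ K * A.card →
        ∃ (H : AddSubgroup G) (r : ℕ) (u : Fin r → G) (N : Fin r → ℕ),
          (H : Set G).Finite ∧ (r : ℝ) ≤ C ∧ (∀ i, 0 < N i) ∧
          (∀ a ∈ A, ∃ h ∈ H, ∃ n : Fin r → ℤ,
            (∀ i, 0 ≤ n i ∧ n i < N i) ∧ a = h + ∑ i, n i • u i) ∧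
          ((H : Set G).ncard : ℝ) * ∏ i, (N i : ℝ) ≤ C * A.card := by
  obtain ⟨k, C, hC1, hC⟩ := exists_large_cosetProgression.{u} K hK
  set L : ℕ := ⌊K ^ 5 * C⌋₊ with hL
  have hC' : (1 : ℝ) ≤ 2 ^ (k + L) * K ^ 4 :=
    one_le_mul_of_one_le_of_one_le (one_le_pow₀ (by norm_num)) (one_le_pow₀ hK)
  refine ⟨(k + L : ℕ) + 2 ^ (k + L) * K ^ 4, by linarith [Nat.cast_nonneg (α := ℝ) (k + L)],
    fun G _ _ _ A hA hAK ↦ ?_⟩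
  obtain ⟨H, r, x, N, hH, hr, hmem, hinj, hcard⟩ := hC G A hA hAK
  let I : Finset (Fin r → ℕ) := Fintype.piFinset fun i ↦ Finset.range (N i + 1)
  have hI (n : Fin r → ℕ) : n ∈ I ↔ ∀ i, n i ≤ N i := by
    simp [I, Fintype.mem_piFinset]
  let B : Finset G := (hH.toFinset ×ˢ I).image fun p ↦ p.1 + ∑ i, p.2 i • x i
  have hB {b : G} (hb : b ∈ B) : ∃ y ∈ H, ∃ n : Fin r → ℕ, (∀ i, n i ≤ N i) ∧
      b = y + ∑ i, n i • x i := by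
    obtain ⟨⟨y, n⟩, hyn, rfl⟩ := Finset.mem_image.1 hb
    rw [Finset.mem_product, hI] at hyn
    exact ⟨y, by simpa using hyn.1, n, hyn.2, rfl⟩
  have hBD : B ⊆ 2 • A - 2 • A := by
    intro b hb
    obtain ⟨y, hy, n, hn, rfl⟩ := hB hb
    exact hmem y hy n hn
  have hBcard : (B.card : ℝ) = (H : Set G).ncard * ∏ i, (N i + 1 : ℝ) := by
    have : B.card = (H : Set G).ncard * ∏ i, (N i + 1) := by
      rw [Finset.card_image_of_injOn, Finset.card_product, Fintype.card_piFinset,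
        Set.ncard_eq_toFinset_card _ hH]
      · simp
      · rintro ⟨y, n⟩ h ⟨y', n'⟩ h' heq
        rw [Finset.mem_coe, Finset.mem_product, hI] at h h'
        obtain ⟨rfl, rfl⟩ := hinj y (by simpa using h.1) y' (by simpa using h'.1) n n' h.2 h'.2 heq
        rfl
    rw [this]; push_cast; rfl
  rw [← hBcard] at hcard
  have hpos : (0 : ℝ) < A.card := by exact_mod_cast hA.card_pos
  have hBne : B.Nonempty := by
    rw [← Finset.card_pos, ← Nat.cast_pos (α := ℝ)]
    by_contra hcon
    nlinarith
  have hBA : (B.card : ℝ) ≤ K ^ 4 * A.card :=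
    le_trans (by exact_mod_cast Finset.card_le_card hBD) (card_nsmul_sub_nsmul_le hA hAK 2 2)
  obtain ⟨F, -, hF, hcov⟩ := Finset.ruzsa_covering_add (A := A) (B := B) (K := K ^ 5 * C) hBne (by
    calc ((A + B).card : ℝ) ≤ ((3 • A - 2 • A).card : ℝ) := by
          have : A + B ⊆ 3 • A - 2 • A := by
            refine (Finset.add_subset_add_left hBD).trans (subset_of_eq ?_)
            rw [← add_sub_assoc, succ_nsmul A 2, add_comm A]
          exact_mod_cast Finset.card_le_card this
      _ ≤ K ^ 5 * A.card := card_nsmul_sub_nsmul_le hA hAK 3 2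
      _ ≤ K ^ 5 * (C * B.card) := by gcongr
      _ = _ := by ring)
  have hFL : F.card ≤ L := Nat.le_floor hF
  have hrL : r + F.card ≤ k + L := by omega
  let e := F.equivFin
  refine ⟨H, r + F.card, Fin.append x fun j ↦ (e.symm j : G) - ∑ i, N i • x i,
    Fin.append (fun i ↦ 2 * N i + 1) fun _ ↦ 2, hH, ?_, ?_, ?_, ?_⟩
  · have : ((r + F.card : ℕ) : ℝ) ≤ (k + L : ℕ) := by exact_mod_cast hrL
    linarith
  · intro i
    refine Fin.addCases (fun j ↦ ?_) (fun j ↦ ?_) i <;> simp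
  · intro a ha
    obtain ⟨f, hf, d, hd, rfl⟩ := Finset.mem_add.1 (hcov ha)
    obtain ⟨b, hb, b', hb', rfl⟩ := Finset.mem_sub.1 hd
    obtain ⟨y, hy, n, hn, rfl⟩ := hB hb
    obtain ⟨y', hy', n', hn', rfl⟩ := hB hb'
    refine ⟨y - y', H.sub_mem hy hy', Fin.append (fun i ↦ (n i : ℤ) - n' i + N i)
      (Pi.single (e ⟨f, hf⟩) 1), fun i ↦ ?_, ?_⟩
    · refine Fin.addCases (fun j ↦ ?_) (fun j ↦ ?_) i
      · have := hn j
        have := hn' j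
        simp only [Fin.append_left]
        push_cast
        omega
      · simp only [Fin.append_right, Pi.single_apply]
        split_ifs <;> norm_num
    · rw [Fin.sum_univ_add]
      simp only [Fin.append_left, Fin.append_right, Pi.single_apply, ite_smul, one_smul, zero_smul,
        Finset.sum_ite_eq', Finset.mem_univ, if_true, Equiv.symm_apply_apply, add_smul, sub_smul,
        natCast_zsmul, Finset.sum_add_distrib, Finset.sum_sub_distrib]
      abel
  · rw [Fin.prod_univ_add]
    simp only [Fin.append_left, Fin.append_right, Finset.prod_const, Finset.card_univ,
      Fintype.card_fin]
    have h1 : ∏ i, ((2 * N i + 1 : ℕ) : ℝ) ≤ 2 ^ r * ∏ i, (N i + 1 : ℝ) := by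
      calc ∏ i, ((2 * N i + 1 : ℕ) : ℝ) ≤ ∏ i, (2 * (N i + 1 : ℝ)) := by
            refine Finset.prod_le_prod (fun _ _ ↦ by positivity) fun i _ ↦ ?_
            push_cast
            linarith
        _ = _ := by rw [Finset.prod_mul_distrib]; simp
    calc ((H : Set G).ncard : ℝ) * ((∏ i, ((2 * N i + 1 : ℕ) : ℝ)) * ((2 : ℕ) : ℝ) ^ F.card)
        ≤ (H : Set G).ncard * ((2 ^ r * ∏ i, (N i + 1 : ℝ)) * 2 ^ F.card) := by
          push_cast at h1 ⊢
          gcongr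
      _ = 2 ^ (r + F.card) * B.card := by rw [hBcard]; ring
      _ ≤ 2 ^ (k + L) * (K ^ 4 * A.card) := by
          gcongr
          norm_num
      _ ≤ _ := by
          rw [add_mul, mul_assoc]
          linarith [mul_nonneg (Nat.cast_nonneg (α := ℝ) (k + L)) hpos.le]

/-- The Green–Ruzsa theorem: a finite set with doubling at most `K` in an abelian group is
contained in a coset progression `H + P` of rank `O_K(1)` and size `O_K(|A|)`. -/
theorem green_ruzsa_theorem (K : ℝ) (hK : 1 ≤ K) :
    ∃ C : ℝ, 1 ≤ C ∧
      ∀ (G : Type*) [AddCommGroup G] [DecidableEq G] (A : Finset G),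
        A.Nonempty → ((A + A).card : ℝ) ≤ K * A.card →
        ∃ (H : AddSubgroup G) (r : ℕ) (u : Fin r → G) (N : Fin r → ℕ),
          (H : Set G).Finite ∧ (r : ℝ) ≤ C ∧ (∀ i, 0 < N i) ∧
          (∀ a ∈ A, ∃ h ∈ H, ∃ n : Fin r → ℤ,
            (∀ i, 0 ≤ n i ∧ n i < N i) ∧ a = h + ∑ i, n i • u i) ∧
          ((H : Set G).ncard : ℝ) * ∏ i, (N i : ℝ) ≤ C * A.card := by
  obtain ⟨C, hC1, hC⟩ := exists_cosetProgression_superset_of_fg K hK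
  refine ⟨C, hC1, fun G _ _ A hA hAK ↦ ?_⟩
  set G₀ := AddSubgroup.closure (A : Set G) with hG₀
  have hsub : (A : Set G) ⊆ G₀ := AddSubgroup.subset_closure
  have hval : Function.Injective G₀.subtype := Subtype.val_injective
  obtain ⟨A₀, hA₀⟩ : ∃ A₀ : Finset G₀, A₀.image G₀.subtype = A := by
    refine ⟨A.attach.image fun a ↦ ⟨a.1, hsub a.2⟩, ?_⟩
    rw [Finset.image_image]
    exact Finset.attach_image_val
  have hcard : A.card = A₀.card := by rw [← hA₀, Finset.card_image_of_injective _ hval]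
  obtain ⟨H, r, u, N, hH, hr, hN, hcov, hsize⟩ := hC G₀ A₀
    (by rw [← hA₀] at hA; exact Finset.image_nonempty.1 hA)
    (by rwa [← hcard, ← Finset.card_image_of_injective (A₀ + A₀) hval, Finset.image_add, hA₀])
  refine ⟨H.map G₀.subtype, r, fun i ↦ u i, N, ?_, hr, hN, ?_, ?_⟩
  · rw [AddSubgroup.coe_map]
    exact hH.image _
  · intro a ha
    rw [← hA₀] at ha
    obtain ⟨b, hb, rfl⟩ := Finset.mem_image.1 ha
    obtain ⟨h, hh, n, hn, rfl⟩ := hcov b hb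
    exact ⟨h, AddSubgroup.mem_map_of_mem _ hh, n, hn, by simp⟩
  · rw [AddSubgroup.coe_map, Set.ncard_image_of_injective _ hval, hcard]
    exact hsize
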